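/- arXiv:2206.08166 — 5 statements merged into one kernel-verified Lean document; each statement's English description precedes it below -/
import Mathlib

section
/- Let C > 0 and let f be a positive, twice continuously differentiable function on the left half-plane H = {z ∈ ℂ : Re z < 0} such that Δ(log f)(z) ≥ 4·C·f(z) for every z ∈ H, where Δ denotes the Laplacian on ℂ ≅ ℝ² (so that (1/4)Δ = ∂²/∂z∂z̄). Then f(z) ≤ (2C)⁻¹ / (Re z)² for every z ∈ H. -/
/-!
Ahlfors' lemma on the left half-plane `H = {z : ℂ | Re z < 0}`:
if `f > 0` is twice continuously differentiable on `H` and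
`Δ (log f) ≥ 4 C f` on `H` (with `C > 0`), then `f z ≤ (2C)⁻¹ / (Re z)²` on `H`.
-/

open Complex

/-- The Laplacian `Δ g = ∂²g/∂x² + ∂²g/∂y²` of a function `g : ℂ → ℝ`,
computed via iterated Fréchet derivatives in the directions `1` and `I`. -/
noncomputable def laplacian (g : ℂ → ℝ) (z : ℂ) : ℝ :=
  fderiv ℝ (fun w => fderiv ℝ g w 1) z 1 + fderiv ℝ (fun w => fderiv ℝ g w Complex.I) z Complex.I

/-- The second derivative of a function is nonpositive at a local maximum. -/
theorem IsLocalMax.deriv_deriv_nonpos {h : ℝ → ℝ} {x : ℝ} (hmax : IsLocalMax h x)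
    (hc : ContinuousAt h x) : deriv (deriv h) x ≤ 0 := by
  by_contra! hpos
  have hmin : IsLocalMin h x := isLocalMin_of_deriv_deriv_pos hpos hmax.deriv_eq_zero hc
  have hconst : h =ᶠ[nhds x] fun _ => h x := by
    filter_upwards [hmax, hmin] with y hy hy'
    exact le_antisymm hy hy'
  have := hconst.deriv.deriv_eq
  simp at this
  linarith

/-- An upper bound for the second derivative of `φ` when `φ` plus twice the logarithm of a
concave quadratic polynomial has a local maximum at `0`. -/
theorem second_deriv_le_of_isLocalMax_add_log {φ φ' : ℝ → ℝ} {a A B : ℝ} (hA : 0 < A)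
    (hφ : ∀ᶠ t in nhds (0 : ℝ), HasDerivAt φ (φ' t) t) (hφ' : HasDerivAt φ' a 0)
    (hmax : IsLocalMax (fun t => φ t + 2 * Real.log (A - 2 * B * t - t ^ 2)) 0) :
    a ≤ 4 / A + 8 * B ^ 2 / A ^ 2 := by
  have hq : ∀ t : ℝ, HasDerivAt (fun t : ℝ => A - 2 * B * t - t ^ 2) (-2 * B - 2 * t) t := by
    intro t
    have h := (((hasDerivAt_id t).const_mul (2 * B)).const_sub A).sub ((hasDerivAt_id t).pow 2)
    exact h.congr_deriv (by simp)
  have hqpos : ∀ᶠ t in nhds (0 : ℝ), 0 < A - 2 * B * t - t ^ 2 :=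
    (hq 0).continuousAt.eventually_const_lt (by simpa using hA)
  have hd : ∀ᶠ t in nhds (0 : ℝ),
      HasDerivAt (fun t => φ t + 2 * Real.log (A - 2 * B * t - t ^ 2))
        (φ' t + 2 * ((-2 * B - 2 * t) / (A - 2 * B * t - t ^ 2))) t := by
    filter_upwards [hφ, hqpos] with t ht hqt
    exact ht.add (((hq t).log hqt.ne').const_mul 2)
  have hd2 : HasDerivAt (fun t => φ' t + 2 * ((-2 * B - 2 * t) / (A - 2 * B * t - t ^ 2)))
      (a - (4 / A + 8 * B ^ 2 / A ^ 2)) 0 := by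
    have hl : HasDerivAt (fun t : ℝ => -2 * B - 2 * t) (-2) 0 := by
      simpa using ((hasDerivAt_id (0 : ℝ)).const_mul 2).const_sub (-2 * B)
    have h := hφ'.add ((hl.div (hq 0) (by simpa using hA.ne')).const_mul 2)
    refine h.congr_deriv ?_
    have := hA.ne'
    simp only [mul_zero, sub_zero, ne_eq, OfNat.ofNat_ne_zero, not_false_eq_true, zero_pow]
    field_simp
    ring
  have hle := hmax.deriv_deriv_nonpos hd.self_of_nhds.continuousAt
  have heq : deriv (fun t => φ t + 2 * Real.log (A - 2 * B * t - t ^ 2)) =ᶠ[nhds 0]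
      fun t => φ' t + 2 * ((-2 * B - 2 * t) / (A - 2 * B * t - t ^ 2)) := by
    filter_upwards [hd] with t ht using ht.deriv
  rw [heq.deriv_eq, hd2.deriv] at hle
  linarith

/-- An upper bound for the second derivative of `u` along a unit vector at a point where
`u + 2 log (R² - |z - c|²)` has a local maximum. -/
theorem second_fderiv_le_of_isLocalMax_add_log {u : ℂ → ℝ} {p c v : ℂ} {R : ℝ}
    (hu : ContDiffAt ℝ 2 u p) (hv : normSq v = 1) (hp : 0 < R ^ 2 - normSq (p - c))
    (hmax : IsLocalMax (fun z => u z + 2 * Real.log (R ^ 2 - normSq (z - c))) p) :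
    fderiv ℝ (fun w => fderiv ℝ u w v) p v ≤ 4 / (R ^ 2 - normSq (p - c)) +
      8 * ((p - c).re * v.re + (p - c).im * v.im) ^ 2 / (R ^ 2 - normSq (p - c)) ^ 2 := by
  have hline : ∀ t : ℝ, HasDerivAt (fun t : ℝ => p + t • v) v t := by
    intro t
    simpa using ((hasDerivAt_id t).smul_const v).const_add p
  have hl0 : Filter.Tendsto (fun t : ℝ => p + t • v) (nhds 0) (nhds p) := by
    simpa using (hline 0).continuousAt.tendsto
  have hdiff : ∀ᶠ z in nhds p, DifferentiableAt ℝ u z := by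
    filter_upwards [hu.eventually (by simp)] with z hz
    exact hz.differentiableAt (by norm_num)
  have hfd : DifferentiableAt ℝ (fun w => fderiv ℝ u w v) p :=
    ((hu.fderiv_right (m := 1) (by norm_num)).differentiableAt (by norm_num)).clm_apply
      (differentiableAt_const v)
  refine second_deriv_le_of_isLocalMax_add_log (φ := fun t => u (p + t • v))
    (φ' := fun t => fderiv ℝ u (p + t • v) v) hp ?_ ?_ ?_
  · filter_upwards [hl0.eventually hdiff] with t ht
    exact ht.hasFDerivAt.comp_hasDerivAt t (hline t)
  · have h : HasFDerivAt (fun w => fderiv ℝ u w v) (fderiv ℝ (fun w => fderiv ℝ u w v) p)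
        (p + (0 : ℝ) • v) := by simpa using hfd.hasFDerivAt
    exact h.comp_hasDerivAt 0 (hline 0)
  · have hq : ∀ t : ℝ, R ^ 2 - normSq (p - c) -
        2 * ((p - c).re * v.re + (p - c).im * v.im) * t - t ^ 2 =
        R ^ 2 - normSq (p + t • v - c) := by
      intro t
      simp only [normSq_apply] at hv ⊢
      simp
      linear_combination (t ^ 2) * hv
    simp only [hq]
    filter_upwards [hl0.eventually hmax] with t ht
    simpa using ht

/-- **Ahlfors' lemma on a disc**: a positive function with `Δ (log f) ≥ 4 C f` near a closed disc
is bounded by the corresponding multiple of the hyperbolic density of the open disc. -/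
theorem ahlfors_disc {C : ℝ} (hC : 0 < C) {f : ℂ → ℝ} {c : ℂ} {R : ℝ} (hR : 0 < R)
    (hpos : ∀ z ∈ Metric.closedBall c R, 0 < f z)
    (hsmooth : ∀ z ∈ Metric.closedBall c R, ContDiffAt ℝ 2 f z)
    (hlap : ∀ z ∈ Metric.closedBall c R,
      4 * C * f z ≤ laplacian (fun w => Real.log (f w)) z) {z : ℂ}
    (hz : z ∈ Metric.closedBall c R) :
    f z * (R ^ 2 - normSq (z - c)) ^ 2 ≤ 2 * R ^ 2 / C := by
  have hcont : ContinuousOn (fun z => f z * (R ^ 2 - normSq (z - c)) ^ 2)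
      (Metric.closedBall c R) := by
    refine ContinuousOn.mul (fun z hz => (hsmooth z hz).continuousAt.continuousWithinAt) ?_
    exact Continuous.continuousOn (by fun_prop)
  obtain ⟨p, hp, hpmax⟩ := (isCompact_closedBall c R).exists_isMaxOn ⟨z, hz⟩ hcont
  refine (hpmax hz).trans ?_
  have hcmem : c ∈ Metric.closedBall c R := Metric.mem_closedBall_self hR.le
  have hvp : 0 < f p * (R ^ 2 - normSq (p - c)) ^ 2 := by
    refine lt_of_lt_of_le ?_ (hpmax hcmem)
    have := hpos c hcmem
    simp
    positivity
  have hball : ∀ w ∈ Metric.ball c R, 0 < R ^ 2 - normSq (w - c) := by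
    intro w hw
    rw [mem_ball_iff_norm] at hw
    rw [normSq_eq_norm_sq]
    nlinarith [norm_nonneg (w - c)]
  have hpball : p ∈ Metric.ball c R := by
    rw [mem_closedBall_iff_norm] at hp
    rw [mem_ball_iff_norm]
    refine lt_of_le_of_ne hp fun h => ?_
    rw [normSq_eq_norm_sq, h] at hvp
    simp at hvp
  have hA := hball p hpball
  have hfp := hpos p hp
  have hmax : IsLocalMax
      (fun z => Real.log (f z) + 2 * Real.log (R ^ 2 - normSq (z - c))) p := by
    filter_upwards [Metric.isOpen_ball.mem_nhds hpball] with w hw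
    have key : ∀ y ∈ Metric.ball c R, Real.log (f y) + 2 * Real.log (R ^ 2 - normSq (y - c)) =
        Real.log (f y * (R ^ 2 - normSq (y - c)) ^ 2) := by
      intro y hy
      rw [Real.log_mul (hpos y (Metric.ball_subset_closedBall hy)).ne'
        (pow_pos (hball y hy) 2).ne', Real.log_pow]
      norm_num
    rw [key w hw, key p hpball]
    have hw' := Metric.ball_subset_closedBall hw
    exact Real.log_le_log (mul_pos (hpos w hw') (pow_pos (hball w hw) 2)) (hpmax hw')
  have hu : ContDiffAt ℝ 2 (fun w => Real.log (f w)) p := (hsmooth p hp).log hfp.ne'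
  have h1 := second_fderiv_le_of_isLocalMax_add_log (v := 1) hu (by simp) hA hmax
  have h2 := second_fderiv_le_of_isLocalMax_add_log (v := Complex.I) hu (by simp) hA hmax
  have h3 := hlap p hp
  unfold laplacian at h3
  have hn := normSq_apply (p - c)
  set A := R ^ 2 - normSq (p - c) with hAdef
  simp only [one_re, one_im, I_re, I_im, mul_one, mul_zero, add_zero, zero_add] at h1 h2
  have hsum : 4 / A + 8 * (p - c).re ^ 2 / A ^ 2 + (4 / A + 8 * (p - c).im ^ 2 / A ^ 2) =
      8 * R ^ 2 / A ^ 2 := by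
    have := hA.ne'
    field_simp
    linear_combination 8 * hAdef - 8 * hn
  have h4 : 4 * C * f p ≤ 8 * R ^ 2 / A ^ 2 := by linarith
  rw [le_div_iff₀ (by positivity)] at h4
  rw [le_div_iff₀ hC]
  linarith

theorem ahlfors_halfplane (C : ℝ) (hC : 0 < C) (f : ℂ → ℝ)
    (hpos : ∀ z : ℂ, z.re < 0 → 0 < f z)
    (hsmooth : ContDiffOn ℝ 2 f {z : ℂ | z.re < 0})
    (hlap : ∀ z : ℂ, z.re < 0 → 4 * C * f z ≤ laplacian (fun w => Real.log (f w)) z) :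
    ∀ z : ℂ, z.re < 0 → f z ≤ (2 * C)⁻¹ / z.re ^ 2 := by
  intro z hz
  have hopen : IsOpen {z : ℂ | z.re < 0} := isOpen_lt continuous_re continuous_const
  have hbound : ∀ s : ℝ, 0 < s → s < -z.re → (-z.re - s) * s < 1 →
      f z ≤ 2 / (C * ((-z.re - s) ^ 2 * (2 - (-z.re - s) * s) ^ 2)) := by
    intro s hs hsx hds
    set d := -z.re - s with hd
    have hdpos : 0 < d := by linarith
    have hR : 0 < s⁻¹ := inv_pos.2 hs
    have hdR : d < s⁻¹ := by rwa [lt_inv_comm₀ hdpos hs, ← one_div, lt_div_iff₀ hdpos, mul_comm]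
    set c : ℂ := z - ((s⁻¹ - d : ℝ) : ℂ) with hc
    have hcre : c.re = z.re - (s⁻¹ - d) := by simp [hc]
    have hsub : ∀ w ∈ Metric.closedBall c s⁻¹, w.re < 0 := by
      intro w hw
      rw [mem_closedBall_iff_norm] at hw
      have := (re_le_norm (w - c)).trans hw
      rw [sub_re, hcre] at this
      linarith
    have hzc : z - c = ((s⁻¹ - d : ℝ) : ℂ) := by simp [hc]
    have hzmem : z ∈ Metric.closedBall c s⁻¹ := by
      rw [mem_closedBall_iff_norm, hzc, norm_real, Real.norm_eq_abs, abs_of_pos (by linarith)]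
      linarith
    have h := ahlfors_disc hC hR (fun w hw => hpos w (hsub w hw))
      (fun w hw => hsmooth.contDiffAt (hopen.mem_nhds (hsub w hw)))
      (fun w hw => hlap w (hsub w hw)) hzmem
    rw [hzc, normSq_ofReal, le_div_iff₀ hC] at h
    have h2 : 0 < 2 - d * s := by linarith
    rw [le_div_iff₀ (by positivity)]
    have hss : s * s⁻¹ = 1 := mul_inv_cancel₀ hs.ne'
    have e1 : s * (s⁻¹ ^ 2 - (s⁻¹ - d) * (s⁻¹ - d)) = d * (2 - d * s) := by
      linear_combination 2 * d * hss
    have h5 := mul_le_mul_of_nonneg_left h (sq_nonneg s)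
    calc f z * (C * (d ^ 2 * (2 - d * s) ^ 2))
        = s ^ 2 * (f z * (s⁻¹ ^ 2 - (s⁻¹ - d) * (s⁻¹ - d)) ^ 2 * C) := by
          rw [← mul_pow, ← e1]; ring
      _ ≤ s ^ 2 * (2 * s⁻¹ ^ 2) := h5
      _ = 2 := by field_simp
  have hx : z.re ≠ 0 := hz.ne
  have hcont : ContinuousAt
      (fun s : ℝ => 2 / (C * ((-z.re - s) ^ 2 * (2 - (-z.re - s) * s) ^ 2))) 0 := by
    refine ContinuousAt.div (by fun_prop) (by fun_prop) ?_
    simp [hC.ne', hx]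
  have hlim := hcont.tendsto.mono_left (nhdsWithin_le_nhds (s := Set.Ioi 0))
  have hval : 2 / (C * ((-z.re - 0) ^ 2 * (2 - (-z.re - 0) * 0) ^ 2)) =
      (2 * C)⁻¹ / z.re ^ 2 := by
    have := hC.ne'
    simp only [sub_zero, mul_zero, neg_sq]
    field_simp
  rw [hval] at hlim
  refine ge_of_tendsto hlim ?_
  have ev1 : ∀ᶠ s : ℝ in nhds 0, s < -z.re := eventually_lt_nhds (by linarith)
  have ev2 : ∀ᶠ s : ℝ in nhds 0, (-z.re - s) * s < 1 :=
    (show ContinuousAt (fun s : ℝ => (-z.re - s) * s) 0 by fun_prop).eventually_lt_const (by simp)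
  filter_upwards [self_mem_nhdsWithin, ev1.filter_mono nhdsWithin_le_nhds,
    ev2.filter_mono nhdsWithin_le_nhds] with s hs h1 h2
  exact hbound s hs h1 h2
end

section
/- Let V be a complex inner product space of finite dimension r ≥ 1, let A be a nilpotent endomorphism of V, and let A* denote its adjoint with respect to the inner product. Then, with respect to the Frobenius norm, ‖[A*, A]‖² ≤ 2‖A‖⁴ and 2‖A‖⁴ ≤ C(r+1,3)·‖[A*, A]‖², where [A*, A] = A*A − AA* and C(r+1,3) = (r+1)r(r−1)/6 is the binomial coefficient. -/
/-!
For a nilpotent endomorphism `A` of a complex inner product space of dimension `r ≥ 1`,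
with adjoint `A*`, the Frobenius norm satisfies
`‖[A*, A]‖² ≤ 2‖A‖⁴` and `2‖A‖⁴ ≤ C(r+1, 3) ‖[A*, A]‖²`.
-/

/-- The square of the Frobenius norm, `‖A‖² = tr(A* A)` (a real number). -/
noncomputable def frobSq {V : Type*} [NormedAddCommGroup V] [InnerProductSpace ℂ V]
    [FiniteDimensional ℂ V] (A : V →ₗ[ℂ] V) : ℝ :=
  (LinearMap.trace ℂ V (LinearMap.adjoint A ∘ₗ A)).re

open scoped ComplexInnerProductSpace in
/-- A nilpotent endomorphism is strictly lower triangular in some orthonormal basis. -/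
theorem exists_orthonormal_strictly_lowerTriangular (n : ℕ) {V : Type*} [NormedAddCommGroup V]
    [InnerProductSpace ℂ V] [FiniteDimensional ℂ V] (hdim : Module.finrank ℂ V = n)
    (A : V →ₗ[ℂ] V) (hA : IsNilpotent A) :
    ∃ e : Fin n → V, Orthonormal ℂ e ∧ ∀ i j, i ≤ j → ⟪e i, A (e j)⟫ = 0 := by
  induction n generalizing V with
  | zero => exact ⟨fun i => i.elim0, ⟨fun i => i.elim0, fun i => i.elim0⟩, fun i => i.elim0⟩
  | succ n ih =>
    have : Nontrivial V := Module.nontrivial_of_finrank_pos (R := ℂ) (by omega)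
    have hB : IsNilpotent (LinearMap.adjoint A) := by
      obtain ⟨k, hk⟩ := hA
      exact ⟨k, by rw [← LinearMap.star_eq_adjoint, ← star_pow, hk, star_zero]⟩
    have hker : LinearMap.ker (LinearMap.adjoint A) ≠ ⊥ := by
      intro h
      obtain ⟨k, hk⟩ := hB
      have hinj := LinearMap.ker_eq_bot.mp h
      obtain ⟨x, hx⟩ := exists_ne (0 : V)
      have hinj' : Function.Injective ⇑(LinearMap.adjoint A ^ k) := by
        rw [Module.End.coe_pow]
        exact hinj.iterate k
      exact hx (hinj' (by simp [hk]))
    obtain ⟨w, hw, hw0⟩ := Submodule.exists_mem_ne_zero_of_ne_bot hker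
    let v : V := (‖w‖⁻¹ : ℂ) • w
    have hv1 : ‖v‖ = 1 := norm_smul_inv_norm hw0
    have hv0 : v ≠ 0 := fun h => by simp [h] at hv1
    have hv : LinearMap.adjoint A v = 0 := by
      simp only [v, map_smul, LinearMap.mem_ker.mp hw, smul_zero]
    have hrange : ∀ x, ⟪v, A x⟫ = 0 := fun x => by
      rw [← LinearMap.adjoint_inner_left, hv, inner_zero_left]
    have hmap : Set.MapsTo A ((ℂ ∙ v)ᗮ : Submodule ℂ V) ((ℂ ∙ v)ᗮ : Submodule ℂ V) :=
      fun x _ => Submodule.mem_orthogonal_singleton_iff_inner_right.mpr (hrange x)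
    have hfin : Module.finrank ℂ ((ℂ ∙ v)ᗮ : Submodule ℂ V) = n := by
      have : Fact (Module.finrank ℂ V = n + 1) := ⟨hdim⟩
      exact Submodule.finrank_orthogonal_span_singleton hv0
    obtain ⟨e, he, hlow⟩ := ih hfin (A.restrict hmap) (Module.End.isNilpotent.restrict hmap hA)
    refine ⟨Matrix.vecCons v (fun i => (e i : V)), ?_, ?_⟩
    · refine orthonormal_vecCons_iff.mpr ⟨hv1, fun i => ?_, ?_⟩
      · exact Submodule.mem_orthogonal_singleton_iff_inner_right.mp (e i).2
      · exact he.comp_linearIsometry ((ℂ ∙ v)ᗮ).subtypeₗᵢ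
    · intro i j hij
      induction i using Fin.cases with
      | zero => exact hrange _
      | succ i =>
        induction j using Fin.cases with
        | zero => simp at hij
        | succ j => exact hlow i j (by simpa using hij)

/-- The Frobenius norm in terms of matrix entries. -/
theorem frobSq_eq_sum_norm_sq {V ι : Type*} [NormedAddCommGroup V] [InnerProductSpace ℂ V]
    [FiniteDimensional ℂ V] [Fintype ι] [DecidableEq ι] (b : OrthonormalBasis ι ℂ V)
    (A : V →ₗ[ℂ] V) :
    frobSq A = ∑ j, ∑ i, ‖LinearMap.toMatrixOrthonormal b A i j‖ ^ 2 := by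
  rw [frobSq, LinearMap.trace_eq_sum_inner _ b, Complex.re_sum]
  refine Finset.sum_congr rfl fun j _ => ?_
  simp only [LinearMap.toMatrixOrthonormal_apply_apply, b.sum_sq_norm_inner_right]
  rw [LinearMap.comp_apply, LinearMap.adjoint_inner_right]
  exact inner_self_eq_norm_sq (𝕜 := ℂ) _

open scoped Matrix Matrix.Norms.Frobenius

theorem Matrix.frobenius_norm_sq {m n : Type*} [Fintype m] [Fintype n] (M : Matrix m n ℂ) :
    ‖M‖ ^ 2 = ∑ j, ∑ i, ‖M i j‖ ^ 2 := by
  rw [Matrix.frobenius_norm_def, ← Real.sqrt_eq_rpow, Real.sq_sqrt (by positivity),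
    Finset.sum_comm]
  simp

theorem Matrix.frobenius_norm_sq_eq_trace {m n : Type*} [Fintype m] [Fintype n]
    (M : Matrix m n ℂ) : ‖M‖ ^ 2 = (Mᴴ * M).trace.re := by
  simp [Matrix.frobenius_norm_sq, Matrix.trace, Matrix.mul_apply, ← Complex.normSq_eq_norm_sq,
    Complex.normSq_apply]

theorem Matrix.frobenius_norm_sq_commutator_le {n : Type*} [Fintype n] [DecidableEq n]
    (M : Matrix n n ℂ) : ‖Mᴴ * M - M * Mᴴ‖ ^ 2 ≤ 2 * (‖M‖ ^ 2) ^ 2 := by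
  have key : ‖Mᴴ * M - M * Mᴴ‖ ^ 2 = 2 * ‖Mᴴ * M‖ ^ 2 - 2 * ‖M * M‖ ^ 2 := by
    have h₁ : (M * Mᴴ * (M * Mᴴ)).trace = (Mᴴ * M * (Mᴴ * M)).trace := by
      rw [Matrix.mul_assoc, Matrix.trace_mul_comm]
      simp only [Matrix.mul_assoc]
    have h₂ : (Mᴴ * M * (M * Mᴴ)).trace = (Mᴴ * Mᴴ * (M * M)).trace := by
      rw [← Matrix.mul_assoc, Matrix.trace_mul_comm]
      simp only [Matrix.mul_assoc]
    have h₃ : (M * Mᴴ * (Mᴴ * M)).trace = (Mᴴ * Mᴴ * (M * M)).trace := by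
      rw [Matrix.trace_mul_comm, h₂]
    simp only [Matrix.frobenius_norm_sq_eq_trace, Matrix.conjTranspose_sub,
      Matrix.conjTranspose_mul, Matrix.conjTranspose_conjTranspose, sub_mul, mul_sub,
      Matrix.trace_sub, Complex.sub_re, h₁, h₂, h₃]
    ring
  have hmul : ‖Mᴴ * M‖ ≤ ‖M‖ ^ 2 := by
    simpa [Matrix.frobenius_norm_conjTranspose, sq] using Matrix.frobenius_norm_mul Mᴴ M
  have hsq : ‖Mᴴ * M‖ ^ 2 ≤ (‖M‖ ^ 2) ^ 2 := by gcongr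
  nlinarith [sq_nonneg ‖M * M‖]

theorem sum_sq_centered_index (r : ℕ) :
    2 * ∑ i : Fin r, (((r : ℝ) - 1) / 2 - i) ^ 2 = (Nat.choose (r + 1) 3 : ℝ) := by
  have hsum : ∀ (c : ℝ) (n : ℕ), ∑ i ∈ Finset.range n, (c - i) ^ 2 =
      n * c ^ 2 - c * (n * (n - 1)) + n * (n - 1) * (2 * n - 1) / 6 := by
    intro c n
    induction n with
    | zero => simp
    | succ n ih => rw [Finset.sum_range_succ, ih]; push_cast; ring
  have hchoose : ∀ n : ℕ, (Nat.choose (n + 1) 3 : ℝ) = (n + 1) * n * (n - 1) / 6 := by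
    intro n
    induction n with
    | zero => simp [Nat.choose_eq_zero_of_lt]
    | succ n ih =>
      rw [Nat.choose_succ_succ' (n + 1) 2, Nat.cast_add, ih, Nat.cast_choose_two]
      push_cast
      ring
  rw [Fin.sum_univ_eq_sum_range (fun i : ℕ => (((r : ℝ) - 1) / 2 - i) ^ 2), hsum, hchoose]
  ring

theorem Matrix.frobenius_norm_sq_le_commutator {r : ℕ} (M : Matrix (Fin r) (Fin r) ℂ)
    (hM : ∀ i j, i ≤ j → M i j = 0) :
    2 * (‖M‖ ^ 2) ^ 2 ≤ (Nat.choose (r + 1) 3 : ℝ) * ‖Mᴴ * M - M * Mᴴ‖ ^ 2 := by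
  set d : Fin r → ℝ := fun i => ((r : ℝ) - 1) / 2 - i with hd
  set h : Fin r → ℝ := fun i => ∑ k, ‖M k i‖ ^ 2 - ∑ k, ‖M i k‖ ^ 2 with hh
  have hdiag : ∀ i, (Mᴴ * M - M * Mᴴ) i i = h i := by
    intro i
    simp [hh, Matrix.mul_apply, Complex.mul_conj', Complex.conj_mul']
  have hle : ∑ i, h i ^ 2 ≤ ‖Mᴴ * M - M * Mᴴ‖ ^ 2 := by
    rw [Matrix.frobenius_norm_sq]
    refine Finset.sum_le_sum fun i _ => ?_
    have := Finset.single_le_sum (f := fun k => ‖(Mᴴ * M - M * Mᴴ) k i‖ ^ 2)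
      (fun k _ => by positivity) (Finset.mem_univ i)
    simpa only [hdiag, Complex.norm_real, Real.norm_eq_abs, sq_abs] using this
  have hweight : ‖M‖ ^ 2 ≤ ∑ i, d i * h i := by
    have hsum : ∑ i, d i * h i = ∑ i, ∑ k, (d i - d k) * ‖M k i‖ ^ 2 := by
      simp only [hh, mul_sub, sub_mul, Finset.sum_sub_distrib, Finset.mul_sum]
      rw [Finset.sum_comm (f := fun i k => d k * ‖M k i‖ ^ 2)]
    rw [hsum, Matrix.frobenius_norm_sq]
    refine Finset.sum_le_sum fun i _ => Finset.sum_le_sum fun k _ => ?_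
    rcases le_or_gt k i with hki | hik
    · simp [hM k i hki]
    · have hlt : ((i : ℕ) : ℝ) + 1 ≤ ((k : ℕ) : ℝ) := by exact_mod_cast hik
      exact le_mul_of_one_le_left (by positivity) (by simp only [hd]; linarith)
  calc 2 * (‖M‖ ^ 2) ^ 2 ≤ 2 * (∑ i, d i * h i) ^ 2 := by gcongr
    _ ≤ 2 * ((∑ i, d i ^ 2) * ∑ i, h i ^ 2) := by
      gcongr
      exact Finset.sum_mul_sq_le_sq_mul_sq _ _ _
    _ ≤ 2 * ((∑ i, d i ^ 2) * ‖Mᴴ * M - M * Mᴴ‖ ^ 2) := by gcongr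
    _ = (Nat.choose (r + 1) 3 : ℝ) * ‖Mᴴ * M - M * Mᴴ‖ ^ 2 := by
      rw [← sum_sq_centered_index r]
      ring

theorem nilpotent_commutator_frobenius_bounds
    {V : Type*} [NormedAddCommGroup V] [InnerProductSpace ℂ V] [FiniteDimensional ℂ V]
    (r : ℕ) (hr : 1 ≤ r) (hdim : Module.finrank ℂ V = r)
    (A : V →ₗ[ℂ] V) (hA : IsNilpotent A) :
    frobSq (LinearMap.adjoint A ∘ₗ A - A ∘ₗ LinearMap.adjoint A) ≤ 2 * frobSq A ^ 2 ∧
      2 * frobSq A ^ 2 ≤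
        (Nat.choose (r + 1) 3 : ℝ) *
          frobSq (LinearMap.adjoint A ∘ₗ A - A ∘ₗ LinearMap.adjoint A) := by
  obtain ⟨e, he, hlow⟩ := exists_orthonormal_strictly_lowerTriangular r hdim A hA
  have hspan : ⊤ ≤ Submodule.span ℂ (Set.range e) :=
    (he.linearIndependent.span_eq_top_of_card_eq_finrank' (by simp [hdim])).ge
  let b : OrthonormalBasis (Fin r) ℂ V := OrthonormalBasis.mk he hspan
  have hb : ∀ i, b i = e i := fun i => by simp [b]
  let M := LinearMap.toMatrixOrthonormal b A
  have hM : ∀ i j, i ≤ j → M i j = 0 := fun i j hij => by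
    simpa only [M, LinearMap.toMatrixOrthonormal_apply_apply, hb] using hlow i j hij
  have hA' : frobSq A = ‖M‖ ^ 2 := by
    rw [frobSq_eq_sum_norm_sq b, Matrix.frobenius_norm_sq]
  have hC : frobSq (LinearMap.adjoint A ∘ₗ A - A ∘ₗ LinearMap.adjoint A) =
      ‖Mᴴ * M - M * Mᴴ‖ ^ 2 := by
    have hmat : LinearMap.toMatrixOrthonormal b
        (LinearMap.adjoint A ∘ₗ A - A ∘ₗ LinearMap.adjoint A) = Mᴴ * M - M * Mᴴ := by
      simp only [← Module.End.mul_eq_comp, ← LinearMap.star_eq_adjoint, map_sub, map_mul, map_star,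
        Matrix.star_eq_conjTranspose, M]
    rw [frobSq_eq_sum_norm_sq b, Matrix.frobenius_norm_sq, hmat]
  rw [hA', hC]
  exact ⟨Matrix.frobenius_norm_sq_commutator_le M, Matrix.frobenius_norm_sq_le_commutator M hM⟩
end

section
/- Let V be a finite-dimensional complex inner product space and let S be a diagonalizable endomorphism of V with real eigenvalues; write V = ⊕_α E_α(S) for the eigenspace decomposition, P_α : V → E_α(S) for the associated projections, and α_min, α_max for the smallest and largest eigenvalues of S. Then for every z ∈ ℂ and every endomorphism A of V, ‖e^{zS} A e^{−zS}‖ ≤ (Σ_α ‖P_α‖)² · e^{(α_max − α_min)|Re z|} · ‖A‖, where ‖·‖ denotes the Frobenius norm. -/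
/-- The Frobenius norm `‖A‖ = √tr(A* A)`. -/
noncomputable def frobNorm {V : Type*} [NormedAddCommGroup V] [InnerProductSpace ℂ V]
    [FiniteDimensional ℂ V] (A : V →ₗ[ℂ] V) : ℝ :=
  Real.sqrt (frobSq A)

open scoped Matrix.Norms.Frobenius in
theorem frobNorm_eq_norm_toMatrix {V : Type*} [NormedAddCommGroup V] [InnerProductSpace ℂ V]
    [FiniteDimensional ℂ V] {n : Type*} [Fintype n] [DecidableEq n] (b : OrthonormalBasis n ℂ V)
    (A : V →ₗ[ℂ] V) :
    frobNorm A = ‖LinearMap.toMatrix b.toBasis b.toBasis A‖ := by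
  rw [frobNorm, frobSq, Matrix.frobenius_norm_def, ← Real.sqrt_eq_rpow]
  congr 1
  rw [LinearMap.trace_eq_matrix_trace ℂ b.toBasis,
    LinearMap.toMatrix_comp b.toBasis b.toBasis b.toBasis, LinearMap.toMatrix_adjoint,
    Matrix.trace, Complex.re_sum, Finset.sum_comm]
  refine Finset.sum_congr rfl fun i _ => ?_
  rw [Matrix.diag_apply, Matrix.mul_apply, Complex.re_sum]
  refine Finset.sum_congr rfl fun j _ => ?_
  rw [Matrix.conjTranspose_apply, Complex.star_def, ← Complex.normSq_eq_conj_mul_self,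
    Complex.ofReal_re, Complex.normSq_eq_norm_sq, Real.rpow_two]

/-- Conjugating by combinations of `P i` whose coefficients satisfy `‖u i‖ * ‖v j‖ ≤ C`. -/
theorem norm_sum_smul_mul_mul_sum_smul_le {𝕜 R ι : Type*} [NormedField 𝕜] [NormedRing R]
    [NormedAlgebra 𝕜 R] [Fintype ι] (P : ι → R) (u v : ι → 𝕜) {C : ℝ}
    (h : ∀ i j, ‖u i‖ * ‖v j‖ ≤ C) (a : R) :
    ‖(∑ i, u i • P i) * (a * ∑ i, v i • P i)‖ ≤ (∑ i, ‖P i‖) ^ 2 * C * ‖a‖ := by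
  have hbound (w : ι → 𝕜) : ‖∑ i, w i • P i‖ ≤ ∑ i, ‖w i‖ * ‖P i‖ :=
    (norm_sum_le _ _).trans_eq (by simp only [norm_smul])
  calc ‖(∑ i, u i • P i) * (a * ∑ i, v i • P i)‖
      ≤ ‖∑ i, u i • P i‖ * (‖a‖ * ‖∑ i, v i • P i‖) := by
        refine (norm_mul_le _ _).trans ?_
        gcongr
        exact norm_mul_le _ _
    _ ≤ (∑ i, ‖u i‖ * ‖P i‖) * (‖a‖ * ∑ j, ‖v j‖ * ‖P j‖) := by
        gcongr <;> apply hbound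
    _ = (∑ i, ∑ j, (‖u i‖ * ‖v j‖) * (‖P i‖ * ‖P j‖)) * ‖a‖ := by
        rw [mul_left_comm, mul_comm, Finset.sum_mul_sum]
        congr 1
        exact Finset.sum_congr rfl fun i _ => Finset.sum_congr rfl fun j _ => by ring
    _ ≤ (∑ i, ∑ j, C * (‖P i‖ * ‖P j‖)) * ‖a‖ := by
        gcongr with i _ j _
        exact h i j
    _ = (∑ i, ‖P i‖) ^ 2 * C * ‖a‖ := by
        simp only [← Finset.mul_sum, ← Finset.sum_mul]
        ring

theorem norm_exp_mul_norm_exp_neg_le {x y m M : ℝ} (hx : x ∈ Set.Icc m M)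
    (hy : y ∈ Set.Icc m M) (z : ℂ) :
    ‖Complex.exp (z * x)‖ * ‖Complex.exp (-z * y)‖ ≤ Real.exp ((M - m) * |z.re|) := by
  rw [Complex.norm_exp, Complex.norm_exp, ← Real.exp_add, Real.exp_le_exp,
    Complex.re_mul_ofReal, Complex.re_mul_ofReal, Complex.neg_re]
  calc z.re * x + -z.re * y = (x - y) * z.re := by ring
    _ ≤ |x - y| * |z.re| := (le_abs_self _).trans_eq (abs_mul _ _)
    _ ≤ (M - m) * |z.re| := by
      gcongr
      exact abs_sub_le_of_le_of_le hx.1 hx.2 hy.1 hy.2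

open scoped Matrix.Norms.Frobenius in
theorem exp_conj_frobenius_bound
    {V : Type*} [NormedAddCommGroup V] [InnerProductSpace ℂ V] [FiniteDimensional ℂ V]
    (ι : Type*) [Fintype ι] [DecidableEq ι] [Nonempty ι]
    -- the eigenvalues of `S` and the associated (spectral) projections
    (α : ι → ℝ) (hinj : Function.Injective α)
    (P : ι → (V →ₗ[ℂ] V)) (hP0 : ∀ i, P i ≠ 0)
    (hPsum : ∑ i, P i = 1)
    (hPorth : ∀ i j, P i ∘ₗ P j = if i = j then P i else 0)
    (S : V →ₗ[ℂ] V) (hS : S = ∑ i, (α i : ℂ) • P i)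
    -- the smallest and largest eigenvalues of `S`
    (αmin αmax : ℝ)
    (hmin : (∀ i, αmin ≤ α i) ∧ ∃ i, α i = αmin)
    (hmax : (∀ i, α i ≤ αmax) ∧ ∃ i, α i = αmax)
    (z : ℂ) (A : V →ₗ[ℂ] V) :
    frobNorm ((∑ i, Complex.exp (z * α i) • P i) ∘ₗ A ∘ₗ
        (∑ i, Complex.exp (-z * α i) • P i)) ≤
      (∑ i, frobNorm (P i)) ^ 2 * Real.exp ((αmax - αmin) * |z.re|) * frobNorm A := by
  let b := stdOrthonormalBasis ℂ V
  simp only [frobNorm_eq_norm_toMatrix b, LinearMap.toMatrix_comp b.toBasis b.toBasis b.toBasis,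
    map_sum, map_smul]
  exact norm_sum_smul_mul_mul_sum_smul_le _ _ _
    (fun i j => norm_exp_mul_norm_exp_neg_le ⟨hmin.1 i, hmax.1 i⟩ ⟨hmin.1 j, hmax.1 j⟩ z) _
end

section
/- Let V be a finite-dimensional complex vector space, Q a nondegenerate hermitian pairing on V, N a nilpotent endomorphism of V with Q(Nv, w) = Q(v, Nw) for all v, w ∈ V, and T_s a diagonalizable automorphism of V with Q(T_s v, T_s w) = Q(v, w) for all v, w and T_s N = N T_s. Let W_• be the monodromy weight filtration of N. Then there exists an endomorphism H of V such that: (a) H is diagonalizable with integer eigenvalues; (b) HN − NH = −2N and W_k = E_k(H) ⊕ W_{k−1} for every k ∈ ℤ, where E_k(H) is the k-eigenspace of H; (c) Q(Hv, w) + Q(v, Hw) = 0 for all v, w ∈ V; (d) H T_s = T_s H. -/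
/-!
Existence of a good splitting of the monodromy weight filtration: given a nondegenerate
hermitian pairing `Q` on `V`, a nilpotent `N` with `Q(Nv,w) = Q(v,Nw)`, and a diagonalizable
automorphism `T_s` preserving `Q` and commuting with `N`, there exists `H ∈ End(V)` that is
diagonalizable with integer eigenvalues, satisfies `[H,N] = −2N`, splits the monodromy weight
filtration `W_k = E_k(H) ⊕ W_{k−1}`, is `Q`-skew (`Q(Hv,w) + Q(v,Hw) = 0`) and commutes
with `T_s`.
-/

/-- A linear endomorphism is diagonalizable (with eigenvalues in `ℤ` when restricted
to integer eigenspaces) iff its eigenspaces span. -/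
def Diagonalizable {V : Type*} [AddCommGroup V] [Module ℂ V] (f : V →ₗ[ℂ] V) : Prop :=
  (⨆ μ : ℂ, Module.End.eigenspace f μ) = ⊤

/-- The monodromy weight filtration of a nilpotent endomorphism `N`:
`W_k = Σ_{j ≥ 0} N^j (ker N^{k+2j+1})`. -/
noncomputable def weightFiltration {V : Type*} [AddCommGroup V] [Module ℂ V]
    (N : V →ₗ[ℂ] V) (k : ℤ) : Submodule ℂ V :=
  ⨆ j : ℕ, Submodule.map (N ^ j) (LinearMap.ker (N ^ (k + 2 * (j : ℤ) + 1).toNat))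

/-- `H` acts on the Jordan strings of `N` with symmetric integer weights, up to terms in deeper
strings. For fixed `N` this is an affine condition on `H`, symmetric under `H ↦ -H*` whenever
`N` is self-adjoint. -/
def IsGrading {V : Type*} [AddCommGroup V] [Module ℂ V] (N H : V →ₗ[ℂ] V) : Prop :=
  (∀ v, H (N v) = N (H v) - (2 : ℂ) • N v) ∧
    ∀ (m : ℕ) (v : V), (N ^ (m + 1)) v = 0 →
      H ((N ^ m) v) + (m : ℂ) • (N ^ m) v ∈ LinearMap.range (N ^ (m + 1))

section Existence

open Polynomial

lemma X_pow_smul_of_intertwine {V M : Type*} [AddCommGroup V] [Module ℂ V] [AddCommGroup M]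
    [Module ℂ[X] M] (N : V →ₗ[ℂ] V) (e : V → M) (he : ∀ v, e (N v) = (X : ℂ[X]) • e v)
    (m : ℕ) (v : V) : e ((N ^ m) v) = (X ^ m : ℂ[X]) • e v := by
  induction m generalizing v with
  | zero => simp
  | succ m ih => rw [pow_succ, Module.End.mul_apply, ih, he, pow_succ, mul_smul]

/-- The operator on `ℂ[X]` sending `X ^ i` to `(n - 1 - 2 * i) • X ^ i`. -/
noncomputable def weightOperator (n : ℕ) : ℂ[X] →ₗ[ℂ] ℂ[X] :=
  ((n : ℂ) - 1) • LinearMap.id -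
    (2 : ℂ) • (Algebra.lsmul ℂ ℂ ℂ[X] (X : ℂ[X]) ∘ₗ Polynomial.derivative)

lemma weightOperator_apply (n : ℕ) (f : ℂ[X]) :
    weightOperator n f = C ((n : ℂ) - 1) * f - C 2 * (X * derivative f) := by
  simp [weightOperator, smul_eq_C_mul]

lemma exists_grading_quotient (n : ℕ) :
    ∃ H : (ℂ[X] ⧸ Submodule.span ℂ[X] {(X : ℂ[X]) ^ n}) →ₗ[ℂ]
        (ℂ[X] ⧸ Submodule.span ℂ[X] {(X : ℂ[X]) ^ n}),
      (∀ v, H ((X : ℂ[X]) • v) = (X : ℂ[X]) • H v - (2 : ℂ) • (X : ℂ[X]) • v) ∧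
      ∀ (m : ℕ) v, (X ^ (m + 1) : ℂ[X]) • v = 0 →
        ∃ y, H ((X ^ m : ℂ[X]) • v) + (m : ℂ) • (X ^ m : ℂ[X]) • v =
          (X ^ (m + 1) : ℂ[X]) • y := by
  set S := Submodule.span ℂ[X] {(X : ℂ[X]) ^ n} with hS
  have memS : ∀ f : ℂ[X], f ∈ S ↔ (X : ℂ[X]) ^ n ∣ f := fun f =>
    Ideal.mem_span_singleton
  have hpres : S.restrictScalars ℂ ≤ (S.restrictScalars ℂ).comap (weightOperator n) := by
    intro f hf
    rw [Submodule.restrictScalars_mem, memS] at hf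
    obtain ⟨g, rfl⟩ := hf
    rw [Submodule.mem_comap, Submodule.restrictScalars_mem, memS, weightOperator_apply]
    refine ⟨C ((n : ℂ) - 1) * g - C 2 * (C (n : ℂ) * g + X * derivative g), ?_⟩
    rcases n with _ | n
    · simp
    · simp [derivative_mul]
      ring
  let H : (ℂ[X] ⧸ S) →ₗ[ℂ] (ℂ[X] ⧸ S) :=
    (S.restrictScalars ℂ).mapQ (S.restrictScalars ℂ) (weightOperator n) hpres
  have hH : ∀ f : ℂ[X], H (Submodule.Quotient.mk f) = Submodule.Quotient.mk (weightOperator n f) :=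
    fun f => rfl
  refine ⟨H, ?_, ?_⟩
  · intro v
    obtain ⟨f, rfl⟩ := Submodule.Quotient.mk_surjective _ v
    rw [← Submodule.Quotient.mk_smul, hH, hH, ← Submodule.Quotient.mk_smul,
      ← Submodule.Quotient.mk_smul, ← Submodule.Quotient.mk_sub]
    congr 1
    simp only [weightOperator_apply, smul_eq_mul, smul_eq_C_mul, derivative_mul, derivative_X]
    ring
  · intro m v hv
    obtain ⟨f, rfl⟩ := Submodule.Quotient.mk_surjective _ v
    rw [← Submodule.Quotient.mk_smul, Submodule.Quotient.mk_eq_zero, memS, smul_eq_mul] at hv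
    rcases Nat.lt_or_ge m n with hmn | hmn
    · obtain ⟨r, rfl⟩ : ∃ r, n = m + 1 + r := ⟨n - (m + 1), by omega⟩
      rw [pow_add, mul_dvd_mul_iff_left (pow_ne_zero _ X_ne_zero)] at hv
      obtain ⟨g, rfl⟩ := hv
      have key : ∃ q : ℂ[X], C ((m : ℂ) - ((m + r : ℕ) : ℂ)) * X ^ (m + r) * g =
          X ^ (m + 1) * q := by
        rcases r with _ | r
        · exact ⟨0, by simp⟩
        · exact ⟨C ((m : ℂ) - ((m + (r + 1) : ℕ) : ℂ)) * X ^ r * g, by ring⟩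
      obtain ⟨q, hq⟩ := key
      refine ⟨Submodule.Quotient.mk q, ?_⟩
      rw [← Submodule.Quotient.mk_smul, hH, ← Submodule.Quotient.mk_smul,
        ← Submodule.Quotient.mk_smul, ← Submodule.Quotient.mk_add, Submodule.Quotient.eq, memS]
      simp only [smul_eq_mul]
      rw [← hq, weightOperator_apply]
      refine ⟨- C 2 * derivative g, ?_⟩
      have hd : X * derivative ((X : ℂ[X]) ^ m * (X ^ r * g)) =
          C ((m + r : ℕ) : ℂ) * X ^ (m + r) * g + X ^ (m + 1 + r) * derivative g := by
        rw [← mul_assoc, ← pow_add]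
        rcases h : m + r with _ | k
        · obtain ⟨rfl, rfl⟩ : m = 0 ∧ r = 0 := by omega
          simp
        · rw [show m + 1 + r = k + 2 by omega]
          simp [derivative_mul]
          ring
      rw [hd, smul_eq_C_mul]
      simp only [Nat.cast_add, Nat.cast_one, C_sub, C_add, C_1]
      have : (C (2 : ℂ)) = 2 := rfl
      rw [this]
      ring
    · have h0 : (X ^ m : ℂ[X]) • (Submodule.Quotient.mk f : ℂ[X] ⧸ S) = 0 := by
        rw [← Submodule.Quotient.mk_smul, Submodule.Quotient.mk_eq_zero, memS, smul_eq_mul]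
        exact (pow_dvd_pow _ hmn).mul_right _
      exact ⟨0, by rw [h0]; simp⟩

lemma exists_isGrading {V : Type*} [AddCommGroup V] [Module ℂ V] [FiniteDimensional ℂ V]
    (N : V →ₗ[ℂ] V) (hN : IsNilpotent N) : ∃ H, IsGrading N H := by
  have htors : Module.IsTorsion' (Module.AEval' N) (Submonoid.powers (X : ℂ[X])) := by
    obtain ⟨n, hn⟩ := hN
    intro v
    refine ⟨⟨X ^ n, n, rfl⟩, ?_⟩
    apply (Module.AEval'.of N).symm.injective
    change aeval N (X ^ n : ℂ[X]) v = 0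
    simp only [map_pow, aeval_X, hn]
    rfl
  obtain ⟨d, k, ⟨e₀⟩⟩ := Module.torsion_by_prime_power_decomposition
    (irreducible_X (R := ℂ)) htors
  let e : V ≃ₗ[ℂ] (∀ i : Fin d, ℂ[X] ⧸ Submodule.span ℂ[X] {(X : ℂ[X]) ^ k i}) :=
    (Module.AEval'.of N).trans
      ((e₀.trans (DirectSum.linearEquivFunOnFintype ℂ[X] _ _)).restrictScalars ℂ)
  have he : ∀ v, e (N v) = (X : ℂ[X]) • e v := by
    intro v
    change (e₀.trans (DirectSum.linearEquivFunOnFintype ℂ[X] _ _)) (Module.AEval'.of N (N v)) = _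
    rw [← Module.AEval'.X_smul_of, map_smul]
    rfl
  have hepow := X_pow_smul_of_intertwine N e he
  choose H hH₁ hH₂ using fun i => exists_grading_quotient (k i)
  let HH : (∀ i : Fin d, ℂ[X] ⧸ Submodule.span ℂ[X] {(X : ℂ[X]) ^ k i}) →ₗ[ℂ]
      (∀ i : Fin d, ℂ[X] ⧸ Submodule.span ℂ[X] {(X : ℂ[X]) ^ k i}) :=
    LinearMap.pi fun i => H i ∘ₗ LinearMap.proj i
  have hHH : ∀ x i, HH x i = H i (x i) := fun _ _ => rfl
  refine ⟨e.symm.toLinearMap ∘ₗ HH ∘ₗ e.toLinearMap, ?_, ?_⟩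
  · intro v
    apply e.injective
    ext i : 1
    simp [he, hHH, hH₁]
  · intro m v hv
    have hv' : ∀ i, (X ^ (m + 1) : ℂ[X]) • e v i = 0 := by
      intro i
      have := congrArg e hv
      rw [hepow, map_zero] at this
      exact congrFun this i
    choose y hy using fun i => hH₂ i m (e v i) (hv' i)
    refine ⟨e.symm y, ?_⟩
    apply e.injective
    ext i : 1
    simp [hepow, hHH, hy]

end Existence

lemma IsGrading.exists_commuting {V : Type*} [AddCommGroup V] [Module ℂ V]
    [FiniteDimensional ℂ V] {N H T : V →ₗ[ℂ] V} (hH : IsGrading N H) (hT : Diagonalizable T)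
    (hTN : T ∘ₗ N = N ∘ₗ T) : ∃ H', IsGrading N H' ∧ H' ∘ₗ T = T ∘ₗ H' := by
  classical
  let s : Finset ℂ := (Module.End.finite_hasEigenvalue T).toFinset
  let π : ℂ → Module.End ℂ V := fun μ => Polynomial.aeval T (Lagrange.basis s id μ)
  have hext : ∀ f g : Module.End ℂ V, (∀ μ ∈ s, ∀ v, T v = μ • v → f v = g v) → f = g := by
    intro f g h
    have hle : (⊤ : Submodule ℂ V) ≤ LinearMap.eqLocus f g := by
      rw [← hT]
      refine iSup_le fun μ v hv => ?_
      rw [LinearMap.mem_eqLocus]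
      rcases eq_or_ne v 0 with rfl | hne
      · simp
      · refine h μ ?_ v (Module.End.mem_eigenspace_iff.mp hv)
        simpa [s] using Module.End.hasEigenvalue_of_hasEigenvector ⟨hv, hne⟩
    exact LinearMap.ext fun v => hle trivial
  have hπ : ∀ μ ∈ s, ∀ ν ∈ s, ∀ v, T v = μ • v → π ν v = if ν = μ then v else 0 := by
    intro μ hμ ν hν v hv
    simp only [π]
    rw [Module.End.aeval_apply_of_mem_apply_eq_smul hv]
    split_ifs with h
    · subst h
      have := Lagrange.eval_basis_self (s := s) (v := id) (i := ν) Function.injective_id.injOn hν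
      simp only [id] at this
      rw [this, one_smul]
    · have := Lagrange.eval_basis_of_ne (s := s) (v := id) (i := ν) (j := μ) h hμ
      simp only [id] at this
      rw [this, zero_smul]
  have hsum : ∑ μ ∈ s, π μ * π μ = 1 := by
    refine hext _ _ fun μ hμ v hv => ?_
    rw [LinearMap.sum_apply, Finset.sum_eq_single μ]
    · simp [hπ μ hμ μ hμ v hv]
    · intro ν hν hne
      simp [hπ μ hμ ν hν v hv, hne]
    · exact fun h => absurd hμ h
  have hTπ : ∀ μ ∈ s, T * π μ = μ • π μ := by
    intro μ hμ
    refine hext _ _ fun ν hν v hv => ?_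
    rw [Module.End.mul_apply, LinearMap.smul_apply, hπ ν hν μ hμ v hv]
    split_ifs with h
    · rw [hv, h]
    · simp
  have hcomm : ∀ g : Module.End ℂ V, T * g = g * T → ∀ μ v, π μ (g v) = g (π μ v) := by
    intro g hg μ v
    have h1 : π μ ∈ Subalgebra.centralizer ℂ {g} := by
      refine Algebra.adjoin_le ?_ (Polynomial.aeval_mem_adjoin_singleton ℂ T)
      rw [Set.singleton_subset_iff, SetLike.mem_coe, Subalgebra.mem_centralizer_iff]
      rintro _ rfl
      exact hg.symm
    rw [Subalgebra.mem_centralizer_iff] at h1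
    exact (LinearMap.congr_fun (h1 g rfl) v).symm
  have hTN' : T * N = N * T := hTN
  have hπpow : ∀ (m : ℕ) μ v, π μ ((N ^ m) v) = (N ^ m) (π μ v) := fun m =>
    hcomm _ ((show Commute T N from hTN').pow_right m)
  have hsum' : ∀ v, ∑ μ ∈ s, π μ (π μ v) = v := fun v => by
    simpa using LinearMap.congr_fun hsum v
  let H' : V →ₗ[ℂ] V := ∑ μ ∈ s, π μ ∘ₗ H ∘ₗ π μ
  have hH' : ∀ v, H' v = ∑ μ ∈ s, π μ (H (π μ v)) := fun v => by simp [H']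
  refine ⟨H', ⟨fun v => ?_, fun m v hv => ?_⟩, ?_⟩
  · rw [hH', hH', map_sum]
    nth_rewrite 3 [← hsum' v]
    rw [map_sum, Finset.smul_sum, ← Finset.sum_sub_distrib]
    refine Finset.sum_congr rfl fun μ _ => ?_
    rw [hcomm N hTN', hH.1, map_sub, map_smul, hcomm N hTN', hcomm N hTN']
  · rw [hH', ← hsum' ((N ^ m) v), Finset.smul_sum]
    simp only [hsum']
    rw [← Finset.sum_add_distrib]
    refine Submodule.sum_mem _ fun μ _ => ?_
    obtain ⟨y, hy⟩ := hH.2 m (π μ v) (by rw [← hπpow, hv, map_zero])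
    refine ⟨π μ y, ?_⟩
    rw [← hπpow, hy, map_add, map_smul, hπpow m μ v]
  · ext v
    simp only [LinearMap.comp_apply, hH', map_sum]
    refine Finset.sum_congr rfl fun μ hμ => ?_
    have h1 : ∀ w, T (π μ w) = μ • π μ w := fun w => LinearMap.congr_fun (hTπ μ hμ) w
    rw [hcomm T rfl, h1, h1, map_smul, map_smul]

section Filtration

variable {V : Type*} [AddCommGroup V] [Module ℂ V]

lemma mem_weightFiltration (N : V →ₗ[ℂ] V) (k : ℤ) (j n : ℕ) (hn : (n : ℤ) ≤ k + 2 * j + 1)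
    (v : V) (hv : (N ^ n) v = 0) : (N ^ j) v ∈ weightFiltration N k := by
  refine Submodule.mem_iSup_of_mem j ⟨v, ?_, rfl⟩
  obtain ⟨r, hr⟩ := Nat.exists_eq_add_of_le (show n ≤ (k + 2 * (j : ℤ) + 1).toNat by omega)
  rw [SetLike.mem_coe, LinearMap.mem_ker, hr, add_comm, pow_add, Module.End.mul_apply, hv, map_zero]

lemma weightFiltration_le {N : V →ₗ[ℂ] V} {k : ℤ} {S : Submodule ℂ V}
    (h : ∀ (j n : ℕ) (v : V), (n : ℤ) = k + 2 * j → (N ^ (n + 1)) v = 0 → (N ^ j) v ∈ S) :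
    weightFiltration N k ≤ S := by
  refine iSup_le fun j => ?_
  rintro _ ⟨v, hv, rfl⟩
  rw [SetLike.mem_coe, LinearMap.mem_ker] at hv
  rcases lt_or_ge (k + 2 * (j : ℤ)) 0 with hneg | hpos
  · rw [show (k + 2 * (j : ℤ) + 1).toNat = 0 by omega] at hv
    have hv0 : v = 0 := hv
    simp [hv0]
  · refine h j (k + 2 * (j : ℤ)).toNat v (by omega) ?_
    rwa [show (k + 2 * (j : ℤ)).toNat + 1 = (k + 2 * (j : ℤ) + 1).toNat by omega]

lemma weightFiltration_mono (N : V →ₗ[ℂ] V) : Monotone (weightFiltration N) := fun k _ hkl =>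
  weightFiltration_le fun j n v hn hv => mem_weightFiltration N _ j (n + 1) (by omega) v hv

lemma weightFiltration_eq_bot {N : V →ₗ[ℂ] V} {n : ℕ} (hN : N ^ n = 0) {k : ℤ} (hk : k ≤ -n) :
    weightFiltration N k = ⊥ := by
  refine le_bot_iff.mp (weightFiltration_le fun j a v ha hv => ?_)
  rw [Submodule.mem_bot]
  rcases le_or_gt n j with h | h
  · simp [pow_eq_zero_of_le h hN]
  · obtain ⟨r, hr⟩ := Nat.exists_eq_add_of_le (show a + 1 ≤ j by omega)
    rw [hr, add_comm, pow_add, Module.End.mul_apply, hv, map_zero]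

lemma weightFiltration_eq_top {N : V →ₗ[ℂ] V} {n : ℕ} (hN : N ^ n = 0) :
    weightFiltration N n = ⊤ := by
  refine eq_top_iff.mpr fun v _ => ?_
  simpa using mem_weightFiltration N n 0 n (by omega) v (by simp [hN])

end Filtration

section Grading

variable {V : Type*} [AddCommGroup V] [Module ℂ V] {N H : V →ₗ[ℂ] V}

lemma IsGrading.apply_pow (hH : IsGrading N H) (m : ℕ) (v : V) :
    H ((N ^ m) v) = (N ^ m) (H v) - (2 * m : ℂ) • (N ^ m) v := by
  induction m generalizing v with
  | zero => simp
  | succ m ih =>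
    rw [pow_succ, Module.End.mul_apply, ih, hH.1, map_sub, map_smul, Module.End.mul_apply]
    push_cast
    module

lemma IsGrading.sub_smul_mem (hH : IsGrading N H) {k : ℤ} {w : V}
    (hw : w ∈ weightFiltration N k) : H w - (k : ℂ) • w ∈ weightFiltration N (k - 1) := by
  suffices weightFiltration N k ≤
      (weightFiltration N (k - 1)).comap (H - (k : ℂ) • LinearMap.id) by
    simpa using this hw
  refine weightFiltration_le fun j n v hn hv => ?_
  obtain ⟨y, hy⟩ := hH.2 n v hv
  have hk : (k : ℂ) = n - 2 * j := by
    have : (n : ℂ) = k + 2 * j := by exact_mod_cast congrArg (Int.cast (R := ℂ)) hn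
    rw [this]; ring
  rw [hH.apply_pow, pow_succ, Module.End.mul_apply] at hy
  have h1 : (N ^ n) (H v - (n : ℂ) • v - N y) = 0 := by
    rw [map_sub, map_sub, map_smul, hy]
    module
  have h2 : (N ^ (n + 2)) y = 0 := by
    have h3 : N ((N ^ n) (H v - (n : ℂ) • v - N y)) = 0 := by rw [h1, map_zero]
    have h4 : (N ^ (n + 1)) (H v) = 0 := by
      have := hH.apply_pow (n + 1) v
      rw [hv, map_zero, smul_zero, sub_zero] at this
      exact this.symm
    rw [← Module.End.mul_apply, ← pow_succ', map_sub, map_sub, map_smul, h4, hv] at h3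
    simpa [pow_succ] using h3
  have h5 := mem_weightFiltration N (k - 1) j n (by omega) _ h1
  have h6 := mem_weightFiltration N (k - 1) (j + 1) (n + 2) (by push_cast; omega) _ h2
  have h7 : H ((N ^ j) v) - (k : ℂ) • (N ^ j) v =
      (N ^ j) (H v - (n : ℂ) • v - N y) + (N ^ (j + 1)) y := by
    rw [hH.apply_pow, pow_succ, Module.End.mul_apply, map_sub, map_sub, map_smul, hk]
    module
  simpa [h7] using Submodule.add_mem _ h5 h6

lemma IsGrading.mem_weightFiltration_of_ne (hH : IsGrading N H) {k l : ℤ} {v : V}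
    (hv : H v = (k : ℂ) • v) (hkl : k ≠ l) (hl : v ∈ weightFiltration N l) :
    v ∈ weightFiltration N (l - 1) := by
  have h := hH.sub_smul_mem hl
  rw [hv, ← sub_smul] at h
  refine (Submodule.smul_mem_iff _ ?_).mp h
  rw [sub_ne_zero]
  exact_mod_cast hkl

lemma IsGrading.eigenspace_le (hH : IsGrading N H) (hN : IsNilpotent N) (k : ℤ) :
    Module.End.eigenspace H (k : ℂ) ≤ weightFiltration N k := by
  obtain ⟨n, hn⟩ := hN
  intro v hv
  rw [Module.End.mem_eigenspace_iff] at hv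
  have h : ∀ i : ℕ, k ≤ (n : ℤ) - i → v ∈ weightFiltration N ((n : ℤ) - i) := by
    intro i
    induction i with
    | zero => simp [weightFiltration_eq_top hn]
    | succ i ih =>
      intro hi
      push_cast at hi ⊢
      rw [← sub_sub]
      exact hH.mem_weightFiltration_of_ne hv (by omega) (ih (by omega))
  rcases le_or_gt k n with hkn | hkn
  · have h' := h (n - k).toNat (by omega)
    rwa [show (n : ℤ) - ((n - k).toNat : ℕ) = k by omega] at h'
  · exact weightFiltration_mono N hkn.le (by simp [weightFiltration_eq_top hn])

lemma IsGrading.disjoint (hH : IsGrading N H) (hN : IsNilpotent N) (k : ℤ) :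
    Disjoint (Module.End.eigenspace H (k : ℂ)) (weightFiltration N (k - 1)) := by
  obtain ⟨n, hn⟩ := hN
  rw [Submodule.disjoint_def]
  intro v hv hvk
  rw [Module.End.mem_eigenspace_iff] at hv
  have h : ∀ i : ℕ, v ∈ weightFiltration N (k - 1 - i) := by
    intro i
    induction i with
    | zero => simpa using hvk
    | succ i ih =>
      push_cast
      rw [← sub_sub]
      exact hH.mem_weightFiltration_of_ne hv (by omega) ih
  have := h (k - 1 + n).toNat
  rwa [weightFiltration_eq_bot hn (by omega), Submodule.mem_bot] at this

lemma IsGrading.weightFiltration_eq (hH : IsGrading N H) (hN : IsNilpotent N) (k : ℤ) :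
    weightFiltration N k =
      Module.End.eigenspace H (k : ℂ) ⊔ weightFiltration N (k - 1) := by
  refine le_antisymm ?_ (sup_le (hH.eigenspace_le hN k) (weightFiltration_mono N (by omega)))
  obtain ⟨n, hn⟩ := hN
  intro w hw
  have h : ∀ i : ℕ, ∃ u ∈ weightFiltration N (k - 1),
      H (w + u) - (k : ℂ) • (w + u) ∈ weightFiltration N (k - 1 - i) := by
    intro i
    induction i with
    | zero => exact ⟨0, Submodule.zero_mem _, by simpa using hH.sub_smul_mem hw⟩
    | succ i ih =>
      obtain ⟨u, hu, hx⟩ := ih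
      set x := H (w + u) - (k : ℂ) • (w + u) with hxdef
      have hc : ((i : ℂ) + 1) ≠ 0 := Nat.cast_add_one_ne_zero i
      refine ⟨u + ((i : ℂ) + 1)⁻¹ • x, Submodule.add_mem _ hu
        (Submodule.smul_mem _ _ (weightFiltration_mono N (by omega) hx)), ?_⟩
      have h1 := Submodule.smul_mem _ ((i : ℂ) + 1)⁻¹ (hH.sub_smul_mem hx)
      push_cast at h1 ⊢
      rw [← sub_sub]
      convert h1 using 1
      rw [← add_assoc, map_add, map_smul, smul_add, ← sub_eq_zero]
      have h2 : H (w + u) = x + (k : ℂ) • (w + u) := by rw [hxdef]; module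
      rw [h2]
      match_scalars <;> field_simp <;> ring
  obtain ⟨u, hu, hx⟩ := h (k - 1 + n).toNat
  rw [weightFiltration_eq_bot hn (by omega), Submodule.mem_bot, sub_eq_zero] at hx
  have : w = (w + u) + -u := by abel
  rw [this]
  exact Submodule.add_mem_sup (Module.End.mem_eigenspace_iff.mpr hx) (Submodule.neg_mem _ hu)

lemma IsGrading.iSup_eigenspace (hH : IsGrading N H) (hN : IsNilpotent N) :
    ⨆ k : ℤ, Module.End.eigenspace H (k : ℂ) = ⊤ := by
  obtain ⟨n, hn⟩ := id hN
  have h : ∀ i : ℕ, weightFiltration N (-(n : ℤ) + i) ≤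
      ⨆ k : ℤ, Module.End.eigenspace H (k : ℂ) := by
    intro i
    induction i with
    | zero => simp [weightFiltration_eq_bot hn]
    | succ i ih =>
      rw [hH.weightFiltration_eq hN]
      refine sup_le (le_iSup (fun k : ℤ => Module.End.eigenspace H (k : ℂ)) _) ?_
      simpa [← add_assoc] using ih
  have h2 := h (2 * n)
  rwa [show -(n : ℤ) + ((2 * n : ℕ) : ℤ) = n by push_cast; ring, weightFiltration_eq_top hn,
    top_le_iff] at h2

end Grading

section Adjoint

variable {V : Type*} [AddCommGroup V] [Module ℂ V] {Q : V →ₗ[ℂ] V →ₛₗ[starRingEnd ℂ] ℂ}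

lemma exists_eq_pairing [FiniteDimensional ℂ V]
    (hnd : ∀ v : V, (∀ w : V, Q v w = 0) → v = 0) (φ : Module.Dual ℂ V) :
    ∃ z, ∀ v, φ v = Q v z := by
  let S : Subspace ℂ (Module.Dual ℂ V) := LinearMap.range Q.flip
  have hS : S.dualCoannihilator = ⊥ := by
    refine le_bot_iff.mp fun v hv => ?_
    rw [Submodule.mem_dualCoannihilator] at hv
    exact hnd v fun w => hv (Q.flip w) ⟨w, rfl⟩
  have hS' : S = ⊤ := by
    rw [← Subspace.dualCoannihilator_dualAnnihilator_eq (W := S), hS,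
      Submodule.dualAnnihilator_bot]
  obtain ⟨z, hz⟩ : φ ∈ S := hS' ▸ Submodule.mem_top
  exact ⟨z, fun v => by rw [← hz]; rfl⟩

lemma eq_of_forall_pairing_eq (hherm : ∀ v w : V, Q w v = starRingEnd ℂ (Q v w))
    (hnd : ∀ v : V, (∀ w : V, Q v w = 0) → v = 0) (a b : V) (h : ∀ v, Q v a = Q v b) : a = b := by
  rw [← sub_eq_zero]
  refine hnd _ fun w => ?_
  rw [hherm w, map_sub, h, sub_self, map_zero]

lemma exists_adjoint [FiniteDimensional ℂ V]
    (hherm : ∀ v w : V, Q w v = starRingEnd ℂ (Q v w))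
    (hnd : ∀ v : V, (∀ w : V, Q v w = 0) → v = 0) (H : V →ₗ[ℂ] V) :
    ∃ H' : V →ₗ[ℂ] V, ∀ v w, Q (H v) w = Q v (H' w) := by
  choose f hf using fun w => exists_eq_pairing hnd (Q.flip w ∘ₗ H)
  have hf' : ∀ w v, Q (H v) w = Q v (f w) := hf
  have hext := eq_of_forall_pairing_eq hherm hnd
  refine ⟨{ toFun := f, map_add' := fun a b => hext _ _ fun v => ?_,
            map_smul' := fun c a => hext _ _ fun v => ?_ }, fun v w => hf' w v⟩
  · simp [← hf']
  · simp [← hf']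

lemma mem_range_of_orthogonal_ker [FiniteDimensional ℂ V]
    (hherm : ∀ v w : V, Q w v = starRingEnd ℂ (Q v w))
    (hnd : ∀ v : V, (∀ w : V, Q v w = 0) → v = 0) {M : V →ₗ[ℂ] V}
    (hM : ∀ v w, Q (M v) w = Q v (M w)) {z : V} (hz : ∀ u, M u = 0 → Q u z = 0) :
    z ∈ LinearMap.range M := by
  have h : Q.flip z ∈ LinearMap.range M.dualMap := by
    rw [LinearMap.range_dualMap_eq_dualAnnihilator_ker, Submodule.mem_dualAnnihilator]
    exact fun u hu => hz u hu
  obtain ⟨ψ, hψ⟩ := h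
  obtain ⟨y, hy⟩ := exists_eq_pairing hnd ψ
  refine ⟨y, eq_of_forall_pairing_eq hherm hnd _ _ fun v => ?_⟩
  rw [← hM, ← hy]
  exact LinearMap.congr_fun hψ v

lemma pow_selfAdjoint {N : V →ₗ[ℂ] V} (hNQ : ∀ v w : V, Q (N v) w = Q v (N w)) (m : ℕ) (v w : V) :
    Q ((N ^ m) v) w = Q v ((N ^ m) w) := by
  induction m generalizing v with
  | zero => rfl
  | succ m ih =>
    rw [pow_succ, Module.End.mul_apply, ih, hNQ, ← Module.End.mul_apply, ← pow_succ', pow_succ]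

lemma IsGrading.average_neg_adjoint [FiniteDimensional ℂ V]
    (hherm : ∀ v w : V, Q w v = starRingEnd ℂ (Q v w))
    (hnd : ∀ v : V, (∀ w : V, Q v w = 0) → v = 0) {N H H' : V →ₗ[ℂ] V}
    (hNQ : ∀ v w : V, Q (N v) w = Q v (N w)) (hH : IsGrading N H)
    (hadj : ∀ v w, Q (H v) w = Q v (H' w)) : IsGrading N ((1 / 2 : ℂ) • (H - H')) := by
  have hH'₁ : ∀ v, H' (N v) = N (H' v) + (2 : ℂ) • N v := by
    intro v
    refine eq_of_forall_pairing_eq hherm hnd _ _ fun u => ?_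
    rw [← hadj, ← hNQ, map_add, ← hNQ, ← hadj, hH.1]
    simp [hNQ, Complex.conj_ofNat]
  refine ⟨fun v => ?_, fun m v hv => ?_⟩
  · simp only [LinearMap.smul_apply, LinearMap.sub_apply, map_sub, map_smul, hH.1, hH'₁]
    module
  · have h₂ : (m : ℂ) • (N ^ m) v - H' ((N ^ m) v) ∈ LinearMap.range (N ^ (m + 1)) := by
      refine mem_range_of_orthogonal_ker hherm hnd (pow_selfAdjoint hNQ _) fun u hu => ?_
      obtain ⟨y, hy⟩ := hH.2 m u hu
      rw [hH.apply_pow] at hy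
      have h3 : Q ((N ^ (m + 1)) y) v = 0 := by rw [pow_selfAdjoint hNQ, hv, map_zero]
      rw [hy] at h3
      rw [map_sub, ← hadj, ← pow_selfAdjoint hNQ, LinearMap.map_smulₛₗ, ← pow_selfAdjoint hNQ]
      simp only [map_add, map_sub, map_smul, LinearMap.add_apply, LinearMap.sub_apply,
        LinearMap.smul_apply, smul_eq_mul, Complex.conj_natCast] at h3 ⊢
      linear_combination -h3
    have h₃ := Submodule.smul_mem _ (1 / 2 : ℂ) (Submodule.add_mem _ (hH.2 m v hv) h₂)
    convert h₃ using 1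
    simp only [LinearMap.smul_apply, LinearMap.sub_apply]
    module

end Adjoint

theorem exists_good_splitting {V : Type*} [AddCommGroup V] [Module ℂ V]
    [FiniteDimensional ℂ V]
    (Q : V →ₗ[ℂ] V →ₛₗ[starRingEnd ℂ] ℂ)
    (hherm : ∀ v w : V, Q w v = starRingEnd ℂ (Q v w))
    (hnd : ∀ v : V, (∀ w : V, Q v w = 0) → v = 0)
    (N : V →ₗ[ℂ] V) (hNnil : IsNilpotent N)
    (hNQ : ∀ v w : V, Q (N v) w = Q v (N w))
    (Ts : V →ₗ[ℂ] V) (hTsunit : Function.Bijective Ts)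
    (hTsdiag : Diagonalizable Ts)
    (hTsQ : ∀ v w : V, Q (Ts v) (Ts w) = Q v w)
    (hTsN : Ts ∘ₗ N = N ∘ₗ Ts) :
    ∃ H : V →ₗ[ℂ] V,
      -- (a) `H` is diagonalizable with integer eigenvalues
      ((⨆ k : ℤ, Module.End.eigenspace H ((k : ℤ) : ℂ)) = ⊤) ∧
      -- (b) `[H, N] = −2N` and `W_k = E_k(H) ⊕ W_{k−1}` for all `k`
      (H ∘ₗ N - N ∘ₗ H = (-2 : ℂ) • N) ∧
      (∀ k : ℤ,
        Disjoint (Module.End.eigenspace H ((k : ℤ) : ℂ)) (weightFiltration N (k - 1)) ∧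
        weightFiltration N k =
          Module.End.eigenspace H ((k : ℤ) : ℂ) ⊔ weightFiltration N (k - 1)) ∧
      -- (c) `Q(Hv, w) + Q(v, Hw) = 0`
      (∀ v w : V, Q (H v) w + Q v (H w) = 0) ∧
      -- (d) `H` commutes with `T_s`
      H ∘ₗ Ts = Ts ∘ₗ H := by
  obtain ⟨H₀, hH₀⟩ := exists_isGrading N hNnil
  obtain ⟨H, hH, hHT⟩ := hH₀.exists_commuting hTsdiag hTsN
  obtain ⟨H', hadj⟩ := exists_adjoint hherm hnd H
  have hG := hH.average_neg_adjoint hherm hnd hNQ hadj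
  have hHT' : ∀ v, H (Ts v) = Ts (H v) := LinearMap.congr_fun hHT
  have hadj' : ∀ v w, Q (H' v) w = Q v (H w) := fun v w => by
    rw [hherm w, ← hadj, ← hherm]
  refine ⟨_, hG.iSup_eigenspace hNnil, ?_,
    fun k => ⟨hG.disjoint hNnil k, hG.weightFiltration_eq hNnil k⟩, fun v w => ?_, ?_⟩
  · refine LinearMap.ext fun v => ?_
    rw [LinearMap.sub_apply, LinearMap.comp_apply, LinearMap.comp_apply, hG.1,
      sub_sub_cancel_left, neg_smul]
    rfl
  · have h1 := hadj v w
    have h2 := hadj' v w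
    simp only [LinearMap.smul_apply, LinearMap.sub_apply, map_sub, map_smul, LinearMap.map_smulₛₗ,
      smul_eq_mul, map_div₀, map_one, Complex.conj_ofNat]
    linear_combination (1 / 2 : ℂ) * h1 - (1 / 2 : ℂ) * h2
  · refine LinearMap.ext fun v => ?_
    have hH'T : H' (Ts v) = Ts (H' v) := by
      refine eq_of_forall_pairing_eq hherm hnd _ _ fun u => ?_
      obtain ⟨u, rfl⟩ := hTsunit.2 u
      rw [← hadj, hTsQ, ← hadj, hHT', hTsQ]
    simp [hHT', hH'T]
end

section
/- Let V be an sl₂-Hodge structure of weight n, with Weil element w = e^X e^{−Y} e^X ∈ GL(V). Then for all i, j ∈ ℤ, setting k = (i + j) − n, one has w(V^{i,j}) = V^{i−k, j−k}. In particular, w restricts to an isomorphism E_k(H) → E_{−k}(H) of the weight spaces which maps the (p,q)-component of the Hodge structure of weight n+k on E_k(H) onto the (p−k, q−k)-component of the Hodge structure of weight n−k on E_{−k}(H). -/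
/-!
In an sl₂-Hodge structure of weight `n`, the Weil element `w = e^X e^{−Y} e^X`
maps `V^{i,j}` onto `V^{i−k, j−k}` where `k = (i+j) − n`, i.e. onto `V^{n−j, n−i}`.
-/

/-- The exponential of a nilpotent endomorphism of a finite-dimensional space,
as the finite sum `Σ_{k ≤ dim V} A^k / k!`. -/
noncomputable def expEnd {V : Type*} [AddCommGroup V] [Module ℂ V] [FiniteDimensional ℂ V]
    (A : V →ₗ[ℂ] V) : V →ₗ[ℂ] V :=
  ∑ k ∈ Finset.range (Module.finrank ℂ V + 1), ((k.factorial : ℂ))⁻¹ • A ^ k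

open Finset in
theorem sum_range_succ_natCast_mul_inv_factorial_smul_pow {A : Type*} [Ring A] [Algebra ℂ A]
    (X : A) (N : ℕ) :
    ∑ k ∈ range (N + 1), ((k : ℂ) * (k.factorial : ℂ)⁻¹) • X ^ k =
      X * ∑ k ∈ range N, (k.factorial : ℂ)⁻¹ • X ^ k := by
  rw [sum_range_succ', mul_sum]
  simp only [Nat.cast_zero, zero_mul, zero_smul, add_zero]
  refine sum_congr rfl fun k _ => ?_
  rw [mul_smul_comm, ← pow_succ', Nat.factorial_succ]
  congr 1
  have : (k.factorial : ℂ) ≠ 0 := by exact_mod_cast k.factorial_ne_zero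
  have : (k : ℂ) + 1 ≠ 0 := by exact_mod_cast k.succ_ne_zero
  push_cast
  field_simp

theorem pow_mul_eq_of_lie_eq_two_smul {A : Type*} [Ring A] [Algebra ℂ A] {H X : A}
    (hHX : H * X - X * H = (2 : ℂ) • X) (k : ℕ) :
    X ^ k * H = H * X ^ k - (2 * k : ℂ) • X ^ k := by
  have h : X * H = H * X - (2 : ℂ) • X := by rw [← hHX]; abel
  induction k with
  | zero => simp
  | succ k ih =>
    rw [pow_succ', mul_assoc, ih, mul_sub, ← mul_assoc, h, mul_smul_comm, sub_mul, smul_mul_assoc,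
      mul_assoc, ← pow_succ']
    push_cast
    module

theorem pow_succ_mul_eq_of_sl2 {A : Type*} [Ring A] [Algebra ℂ A] {H X Y : A}
    (hHX : H * X - X * H = (2 : ℂ) • X) (hXY : X * Y - Y * X = H) (k : ℕ) :
    X ^ (k + 1) * Y =
      Y * X ^ (k + 1) + (k + 1 : ℂ) • (H * X ^ k) - ((k + 1 : ℂ) * k) • X ^ k := by
  have h : X * H = H * X - (2 : ℂ) • X := by rw [← hHX]; abel
  have h' : X * Y = Y * X + H := by rw [← hXY]; abel
  induction k with
  | zero => simp [h']
  | succ k ih =>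
    rw [pow_succ' X (k + 1), mul_assoc, ih, mul_sub, mul_add, ← mul_assoc, h', mul_smul_comm,
      mul_smul_comm, ← mul_assoc X H, h, sub_mul, add_mul, smul_mul_assoc, mul_assoc, mul_assoc,
      ← pow_succ', ← pow_succ']
    push_cast
    module

theorem Module.End.pow_finrank_eq_zero_of_isNilpotent {K V : Type*} [Field K] [AddCommGroup V]
    [Module K V] [FiniteDimensional K V] {A : Module.End K V} (hA : IsNilpotent A) :
    A ^ Module.finrank K V = 0 := by
  have h := LinearMap.aeval_self_charpoly A
  rwa [hA.charpoly_eq_X_pow_finrank, map_pow, Polynomial.aeval_X] at h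

section expEnd

variable {V : Type*} [AddCommGroup V] [Module ℂ V] [FiniteDimensional ℂ V]

theorem expEnd_eq_sum_range_finrank {A : Module.End ℂ V} (hA : IsNilpotent A) :
    expEnd A = ∑ k ∈ Finset.range (Module.finrank ℂ V), (k.factorial : ℂ)⁻¹ • A ^ k := by
  rw [expEnd, Finset.sum_range_succ, Module.End.pow_finrank_eq_zero_of_isNilpotent hA, smul_zero,
    add_zero]

theorem mul_expEnd_eq_sum {A : Module.End ℂ V} (hA : IsNilpotent A) :
    A * expEnd A = ∑ k ∈ Finset.range (Module.finrank ℂ V + 1),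
      ((k : ℂ) * (k.factorial : ℂ)⁻¹) • A ^ k := by
  rw [sum_range_succ_natCast_mul_inv_factorial_smul_pow, ← expEnd_eq_sum_range_finrank hA]

theorem expEnd_eq_exp [Module ℚ (Module.End ℂ V)] {A : Module.End ℂ V} (hA : IsNilpotent A) :
    expEnd A = IsNilpotent.exp A := by
  rw [expEnd_eq_sum_range_finrank hA,
    IsNilpotent.exp_eq_sum (Module.End.pow_finrank_eq_zero_of_isNilpotent hA)]
  refine Finset.sum_congr rfl fun k _ => ?_
  rw [inv_natCast_smul_eq ℂ ℚ]

theorem expEnd_mul_expEnd_neg {A : Module.End ℂ V} (hA : IsNilpotent A) :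
    expEnd A * expEnd (-A) = 1 := by
  let : Module ℚ (Module.End ℂ V) := Module.compHom _ (algebraMap ℚ ℂ)
  rw [expEnd_eq_exp hA, expEnd_eq_exp hA.neg, IsNilpotent.exp_mul_exp_neg_self hA]

theorem commute_expEnd {D A : Module.End ℂ V} (h : Commute D A) : Commute D (expEnd A) :=
  Commute.sum_right _ _ _ fun k _ => (h.pow_right k).smul_right _

theorem expEnd_mul_of_lie_eq_two_smul {H X : Module.End ℂ V} (hX : IsNilpotent X)
    (hHX : H * X - X * H = (2 : ℂ) • X) :
    expEnd X * H = (H - (2 : ℂ) • X) * expEnd X := by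
  rw [sub_mul, smul_mul_assoc, mul_expEnd_eq_sum hX, expEnd, Finset.sum_mul, Finset.mul_sum,
    Finset.smul_sum, ← Finset.sum_sub_distrib]
  refine Finset.sum_congr rfl fun k _ => ?_
  rw [smul_mul_assoc, pow_mul_eq_of_lie_eq_two_smul hHX, mul_smul_comm]
  module

theorem expEnd_mul_of_sl2 {H X Y : Module.End ℂ V} (hX : IsNilpotent X)
    (hHX : H * X - X * H = (2 : ℂ) • X) (hXY : X * Y - Y * X = H) :
    expEnd X * Y = (Y + H - X) * expEnd X := by
  have hX' : X * expEnd X = ∑ k ∈ Finset.range (Module.finrank ℂ V),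
      ((k : ℂ) * (k.factorial : ℂ)⁻¹) • X ^ k := by
    rw [mul_expEnd_eq_sum hX, Finset.sum_range_succ,
      Module.End.pow_finrank_eq_zero_of_isNilpotent hX, smul_zero, add_zero]
  have hH : H * expEnd X = ∑ k ∈ Finset.range (Module.finrank ℂ V),
      (k.factorial : ℂ)⁻¹ • (H * X ^ k) := by
    rw [expEnd_eq_sum_range_finrank hX, Finset.mul_sum]
    simp only [mul_smul_comm]
  rw [sub_mul, add_mul, hX', hH, expEnd, Finset.sum_mul, Finset.mul_sum, Finset.sum_range_succ',
    Finset.sum_range_succ' _ (Module.finrank ℂ V), add_right_comm, add_sub_right_comm,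
    ← Finset.sum_add_distrib, ← Finset.sum_sub_distrib]
  congr 1
  · refine Finset.sum_congr rfl fun k _ => ?_
    have h₁ : (k.factorial : ℂ) ≠ 0 := by exact_mod_cast k.factorial_ne_zero
    have h₂ : (k : ℂ) + 1 ≠ 0 := by exact_mod_cast k.succ_ne_zero
    rw [smul_mul_assoc, pow_succ_mul_eq_of_sl2 hHX hXY, mul_smul_comm, Nat.factorial_succ]
    push_cast
    match_scalars <;> field_simp
  · simp

theorem weil_mul_eq_neg_mul_weil {H X Y : Module.End ℂ V} (hX : IsNilpotent X)
    (hY : IsNilpotent Y) (hHX : H * X - X * H = (2 : ℂ) • X)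
    (hHY : H * Y - Y * H = (-2 : ℂ) • Y) (hXY : X * Y - Y * X = H) :
    expEnd X * expEnd (-Y) * expEnd X * H = -(H * (expEnd X * expEnd (-Y) * expEnd X)) := by
  have hXH := expEnd_mul_of_lie_eq_two_smul hX hHX
  have hHY' : -H * -Y - -Y * -H = (2 : ℂ) • -Y := by
    rw [neg_mul_neg, neg_mul_neg, hHY]; module
  have hYX' : -Y * -X - -X * -Y = -H := by
    rw [neg_mul_neg, neg_mul_neg, ← hXY]; abel
  have hYH : expEnd (-Y) * H = (H - (2 : ℂ) • Y) * expEnd (-Y) := by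
    have h := expEnd_mul_of_lie_eq_two_smul hY.neg hHY'
    rw [mul_neg] at h
    rw [← neg_inj, h, ← neg_mul]
    congr 1
    module
  have hYX : expEnd (-Y) * X = (X + H - Y) * expEnd (-Y) := by
    have h := expEnd_mul_of_sl2 hY.neg hHY' hYX'
    rw [mul_neg] at h
    rw [← neg_inj, h, ← neg_mul]
    congr 1
    abel
  have hXX : expEnd X * X = X * expEnd X := (commute_expEnd (Commute.refl X)).symm.eq
  have hY' : expEnd (-Y) * (H - (2 : ℂ) • X) = (-H - (2 : ℂ) • X) * expEnd (-Y) := by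
    rw [mul_sub, mul_smul_comm, hYH, hYX, ← smul_mul_assoc, ← sub_mul]
    congr 1
    module
  have hX' : expEnd X * (-H - (2 : ℂ) • X) = -H * expEnd X := by
    rw [mul_sub, mul_smul_comm, mul_neg, hXH, hXX, ← smul_mul_assoc, ← neg_mul, ← sub_mul]
    congr 1
    module
  calc expEnd X * expEnd (-Y) * expEnd X * H
      = expEnd X * (expEnd (-Y) * (H - (2 : ℂ) • X)) * expEnd X := by
        rw [mul_assoc _ _ H, hXH]; simp only [mul_assoc]
    _ = expEnd X * (-H - (2 : ℂ) • X) * expEnd (-Y) * expEnd X := by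
        rw [hY']; simp only [mul_assoc]
    _ = _ := by rw [hX']; simp only [mul_assoc, neg_mul]

end expEnd

namespace DirectSum.IsInternal

variable {K V ι : Type*} [DecidableEq ι] [Field K] [AddCommGroup V] [Module K V]
  {W : ι → Submodule K V}

theorem linearMap_ext {V' : Type*} [AddCommGroup V'] [Module K V'] (hW : DirectSum.IsInternal W)
    {A B : V →ₗ[K] V'} (h : ∀ i, ∀ v ∈ W i, A v = B v) : A = B := by
  refine LinearMap.ext fun v => ?_
  have hv : v ∈ ⨆ i, W i := hW.submodule_iSup_eq_top ▸ Submodule.mem_top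
  induction hv using Submodule.iSup_induction' with
  | mem i v hv => exact h i v hv
  | zero => simp
  | add x y _ _ hx hy => rw [map_add, map_add, hx, hy]

theorem exists_diagonal (hW : DirectSum.IsInternal W) (c : ι → K) :
    ∃ D : Module.End K V, ∀ i, ∀ v ∈ W i, D v = c i • v := by
  let e := LinearEquiv.ofBijective (DirectSum.coeLinearMap W) hW
  refine ⟨DirectSum.toModule K ι V (fun i => c i • (W i).subtype) ∘ₗ e.symm.toLinearMap,
    fun i v hv => ?_⟩
  have he : e.symm v = DirectSum.lof K ι (fun i => W i) i ⟨v, hv⟩ := by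
    rw [LinearEquiv.symm_apply_eq]
    exact (DirectSum.coeLinearMap_lof W i ⟨v, hv⟩).symm
  simp [he]

theorem mem_of_joint_eigenvector (hW : DirectSum.IsInternal W) {A B : Module.End K V}
    {a b : ι → K} (hA : ∀ i, ∀ v ∈ W i, A v = a i • v) (hB : ∀ i, ∀ v ∈ W i, B v = b i • v)
    {i : ι} (hi : ∀ j, a j = a i → b j = b i → j = i) {v : V}
    (hAv : A v = a i • v) (hBv : B v = b i • v) : v ∈ W i := by
  let e := LinearEquiv.ofBijective (DirectSum.coeLinearMap W) hW
  have he : ∀ y, e y = DirectSum.coeLinearMap W y := fun y => rfl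
  have key : ∀ {C : Module.End K V} {c : ι → K}, (∀ j, ∀ v ∈ W j, C v = c j • v) →
      C v = c i • v → ∀ j, c j ≠ c i → e.symm v j = 0 := by
    intro C c hC hCv j hj
    have hcomp : DirectSum.component K ι (fun i => W i) j ∘ₗ e.symm.toLinearMap ∘ₗ C =
        c j • (DirectSum.component K ι (fun i => W i) j ∘ₗ e.symm.toLinearMap) := by
      refine hW.linearMap_ext fun l x hx => ?_
      have hx' : e.symm x = DirectSum.lof K ι (fun i => W i) l ⟨x, hx⟩ := by
        rw [LinearEquiv.symm_apply_eq]
        exact (DirectSum.coeLinearMap_lof W l ⟨x, hx⟩).symm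
      rcases eq_or_ne l j with rfl | hlj
      · simp [hC l x hx]
      · simp [hC l x hx, hx', DirectSum.component.of, hlj]
    have h := LinearMap.congr_fun hcomp v
    simp only [LinearMap.comp_apply, LinearMap.smul_apply, hCv, map_smul] at h
    rw [← sub_eq_zero, ← sub_smul] at h
    exact (smul_eq_zero.mp h).resolve_left (sub_ne_zero.mpr hj.symm)
  have hv : e.symm v = DirectSum.lof K ι (fun i => W i) i (e.symm v i) := by
    refine DFinsupp.ext fun j => ?_
    rcases eq_or_ne j i with rfl | hji
    · exact (DirectSum.lof_apply (M := fun i => W i) K j _).symm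
    · rw [DirectSum.lof_eq_of, DirectSum.of_eq_of_ne _ _ _ hji]
      by_cases ha : a j = a i
      · exact key hB hBv j fun hb => hji (hi j ha hb)
      · exact key hA hAv j ha
  rw [LinearEquiv.symm_apply_eq, he, DirectSum.coeLinearMap_lof] at hv
  rw [hv]
  exact Subtype.property _

theorem isNilpotent_of_mapsTo [FiniteDimensional K V] (hW : DirectSum.IsInternal W)
    {A : Module.End K V} {s : ι → ι} (hs : ∀ i, Function.Injective fun m : ℕ => s^[m] i)
    (hA : ∀ i, ∀ v ∈ W i, A v ∈ W (s i)) : IsNilpotent A := by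
  have hpow : ∀ (m : ℕ) (i : ι), ∀ v ∈ W i, (A ^ m) v ∈ W (s^[m] i) := by
    intro m
    induction m with
    | zero => simp
    | succ m ih =>
      intro i v hv
      rw [pow_succ', Module.End.mul_apply, Function.iterate_succ_apply']
      exact hA _ _ (ih i v hv)
  have hfin : {i | W i ≠ ⊥}.Finite :=
    WellFoundedGT.finite_ne_bot_of_iSupIndep hW.submodule_iSupIndep
  refine Module.End.isNilpotent_iff_of_finite.mpr fun v => ?_
  have hv : v ∈ ⨆ i, W i := hW.submodule_iSup_eq_top ▸ Submodule.mem_top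
  induction hv using Submodule.iSup_induction' with
  | mem i v hv =>
    by_contra! h
    refine Set.infinite_univ (hfin.preimage (hs i).injOn |>.subset fun m _ => ?_)
    exact fun hbot => h m (by simpa [hbot] using hpow m i v hv)
  | zero => exact ⟨0, map_zero _⟩
  | add x y _ _ hx hy =>
    obtain ⟨m, hm⟩ := hx
    obtain ⟨l, hl⟩ := hy
    refine ⟨m + l, ?_⟩
    have hx : (A ^ (m + l)) x = 0 := by rw [add_comm, pow_add, Module.End.mul_apply, hm, map_zero]
    have hy : (A ^ (m + l)) y = 0 := by rw [pow_add, Module.End.mul_apply, hl, map_zero]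
    rw [map_add, hx, hy, add_zero]

theorem commute_of_mapsTo (hW : DirectSum.IsInternal W) {A D : Module.End K V} {c : ι → K}
    {s : ι → ι} (hD : ∀ i, ∀ v ∈ W i, D v = c i • v) (hc : ∀ i, c (s i) = c i)
    (hA : ∀ i, ∀ v ∈ W i, A v ∈ W (s i)) : Commute D A := by
  refine hW.linearMap_ext fun i v hv => ?_
  rw [Module.End.mul_apply, Module.End.mul_apply, hD i v hv, hD _ _ (hA i v hv), hc, map_smul]

end DirectSum.IsInternal

theorem weil_element_maps_bigraded_pieces
    {V : Type*} [AddCommGroup V] [Module ℂ V] [FiniteDimensional ℂ V]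
    (n : ℤ) (H X Y : V →ₗ[ℂ] V)
    -- the sl₂-relations
    (hHX : H ∘ₗ X - X ∘ₗ H = (2 : ℂ) • X)
    (hHY : H ∘ₗ Y - Y ∘ₗ H = (-2 : ℂ) • Y)
    (hXY : X ∘ₗ Y - Y ∘ₗ X = H)
    -- the bigrading `V = ⊕_{i,j} V^{i,j}`
    (Vb : ℤ → ℤ → Submodule ℂ V)
    (hdec : DirectSum.IsInternal (fun ij : ℤ × ℤ => Vb ij.1 ij.2))
    (hH : ∀ i j : ℤ, ∀ v ∈ Vb i j, H v = ((i + j - n : ℤ) : ℂ) • v)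
    (hX : ∀ i j : ℤ, Submodule.map X (Vb i j) ≤ Vb (i + 1) (j + 1))
    (hY : ∀ i j : ℤ, Submodule.map Y (Vb i j) ≤ Vb (i - 1) (j - 1)) :
    ∀ i j : ℤ,
      Submodule.map (expEnd X ∘ₗ expEnd (-Y) ∘ₗ expEnd X) (Vb i j) = Vb (n - j) (n - i) := by
  have hX' : ∀ ij : ℤ × ℤ, ∀ v ∈ Vb ij.1 ij.2, X v ∈ Vb (ij.1 + 1) (ij.2 + 1) :=
    fun ij v hv => hX ij.1 ij.2 (Submodule.mem_map_of_mem hv)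
  have hY' : ∀ ij : ℤ × ℤ, ∀ v ∈ Vb ij.1 ij.2, Y v ∈ Vb (ij.1 - 1) (ij.2 - 1) :=
    fun ij v hv => hY ij.1 ij.2 (Submodule.mem_map_of_mem hv)
  have hXn : IsNilpotent X := by
    refine hdec.isNilpotent_of_mapsTo (s := fun ij => (ij.1 + 1, ij.2 + 1)) (fun ij => ?_) hX'
    have h : ∀ m : ℕ, ((fun ij : ℤ × ℤ => (ij.1 + 1, ij.2 + 1))^[m] ij).1 = ij.1 + m := by
      intro m
      induction m with
      | zero => simp
      | succ m ih => rw [Function.iterate_succ_apply', ih]; push_cast; ring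
    intro m l hml
    have := congrArg Prod.fst hml
    simp only [h] at this
    omega
  have hYn : IsNilpotent Y := by
    refine hdec.isNilpotent_of_mapsTo (s := fun ij => (ij.1 - 1, ij.2 - 1)) (fun ij => ?_) hY'
    have h : ∀ m : ℕ, ((fun ij : ℤ × ℤ => (ij.1 - 1, ij.2 - 1))^[m] ij).1 = ij.1 - m := by
      intro m
      induction m with
      | zero => simp
      | succ m ih => rw [Function.iterate_succ_apply', ih]; push_cast; ring
    intro m l hml
    have := congrArg Prod.fst hml
    simp only [h] at this
    omega
  obtain ⟨D, hD⟩ := hdec.exists_diagonal fun ij => ((ij.1 - ij.2 : ℤ) : ℂ)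
  have hDX : Commute D X :=
    hdec.commute_of_mapsTo (s := fun ij => (ij.1 + 1, ij.2 + 1)) hD (fun ij => by simp) hX'
  have hDY : Commute D Y :=
    hdec.commute_of_mapsTo (s := fun ij => (ij.1 - 1, ij.2 - 1)) hD (fun ij => by simp) hY'
  have hmem : ∀ w : Module.End ℂ V, w * H = -(H * w) → Commute D w →
      ∀ i j, ∀ v ∈ Vb i j, w v ∈ Vb (n - j) (n - i) := by
    intro w hwH hwD i j v hv
    refine hdec.mem_of_joint_eigenvector (i := (n - j, n - i)) (A := H) (B := D)
      (a := fun ij => ((ij.1 + ij.2 - n : ℤ) : ℂ)) (fun ij => hH ij.1 ij.2) hD ?_ ?_ ?_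
    · rintro ⟨p, q⟩ h₁ h₂
      have h₁ := Int.cast_injective h₁
      have h₂ := Int.cast_injective h₂
      simp only at h₁ h₂
      ext <;> simp only <;> omega
    · have h := LinearMap.congr_fun hwH v
      rw [Module.End.mul_apply, LinearMap.neg_apply, Module.End.mul_apply, hH i j v hv, map_smul,
        eq_comm, neg_eq_iff_eq_neg] at h
      rw [h, ← neg_smul]
      push_cast
      congr 1
      ring
    · have h := LinearMap.congr_fun hwD.eq v
      rw [Module.End.mul_apply, Module.End.mul_apply, hD (i, j) v hv, map_smul] at h
      rw [h]
      push_cast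
      congr 1
      ring
  have hw := hmem (expEnd X * expEnd (-Y) * expEnd X)
    (weil_mul_eq_neg_mul_weil hXn hYn hHX hHY hXY)
    (((commute_expEnd hDX).mul_right (commute_expEnd hDY.neg_right)).mul_right (commute_expEnd hDX))
  have hw' := hmem (expEnd (-X) * expEnd (- -Y) * expEnd (-X))
    (weil_mul_eq_neg_mul_weil hXn.neg hYn.neg
      (by rw [mul_neg, neg_mul, sub_neg_eq_add, neg_add_eq_sub, ← neg_sub, smul_neg]
          exact congrArg _ hHX)
      (by rw [mul_neg, neg_mul, sub_neg_eq_add, neg_add_eq_sub, ← neg_sub, smul_neg]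
          exact congrArg _ hHY)
      (by rw [neg_mul_neg, neg_mul_neg]; exact hXY))
    (((commute_expEnd hDX.neg_right).mul_right (commute_expEnd hDY.neg_right.neg_right)).mul_right
      (commute_expEnd hDX.neg_right))
  have hinv : (expEnd X * expEnd (-Y) * expEnd X) *
      (expEnd (-X) * expEnd (- -Y) * expEnd (-X)) = 1 := by
    have h₁ := expEnd_mul_expEnd_neg hXn
    have h₂ := expEnd_mul_expEnd_neg hYn.neg
    calc _ = expEnd X * (expEnd (-Y) * (expEnd X * expEnd (-X)) * expEnd (- -Y)) *
          expEnd (-X) := by simp only [mul_assoc]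
      _ = 1 := by rw [h₁, mul_one, h₂, mul_one, h₁]
  intro i j
  refine le_antisymm (Submodule.map_le_iff_le_comap.mpr fun v hv => hw i j v hv) fun v hv => ?_
  refine ⟨_, ?_, LinearMap.congr_fun hinv v⟩
  simpa using hw' _ _ v hv
end
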